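/- arXiv:0904.4206 — 2 statements merged into one kernel-verified Lean document; each statement's English description precedes it below -/
import Mathlib

section
/- Let P be a multiplicity-one-free étale phrase of length k over α (i.e., every letter occurring in P occurs at least twice) whose total length (the sum of the lengths of its k components) is at most three. Then P is either homotopic to (∅)_k or homotopic to one of the étale phrases P^{1,1;l₁,l₂}_a, P^{3;l}_a (with a ≠ τ(a)), P^{2,1;l₁,l₂}_a, P^{1,2;l₁,l₂}_a, P^{1,1,1;l₁,l₂,l₃}_a for some indices l, l₁ < l₂ < l₃ in {1,…,k} and some a ∈ α. Moreover, two phrases from the list P^{1,1;l₁,l₂}_a, P^{3;l}_a, P^{2,1;l₁,l₂}_a, P^{1,2;l₁,l₂}_a, P^{1,1,1;l₁,l₂,l₃}_a are homotopic if and only if they are equal. -/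
namespace Nano

variable {α : Type*}

/-- A letter: an identifier together with its projection to the alphabet `α`. -/
abbrev Letter (α : Type*) := ℕ × α

/-- The projection of a letter. -/
def proj (A : Letter α) : α := A.2

/-- A phrase: a finite sequence of words, each word a list of letters. -/
abbrev Phrase (α : Type*) := List (List (Letter α))

/-- Flatten a phrase into one list, separating components by `none` (the `|` character). -/
def flat (P : Phrase α) : List (Option (Letter α)) :=
  List.intercalate [none] (P.map fun w => w.map some)

/-- The `i`-th component (word) of a phrase (0-indexed). -/
def comp (P : Phrase α) (i : ℕ) : List (Letter α) := P.getD i []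

/-- A phrase is a Gauss phrase if every letter occurring in it occurs exactly twice. -/
def IsGauss [DecidableEq α] (P : Phrase α) : Prop :=
  ∀ A ∈ P.flatten, P.flatten.count A = 2

/-- All letters of `P` project into the subset `β` of `α`. -/
def ProjIn (β : Set α) (P : Phrase α) : Prop := ∀ A ∈ P.flatten, A.2 ∈ β

/-- Renaming of letters (injective renamings give isomorphisms of `α`-alphabets,
preserving the projection). -/
def rename (f : ℕ → ℕ) (P : Phrase α) : Phrase α :=
  P.map (List.map fun A => (f A.1, A.2))

/-- One elementary step: an isomorphism or one of the homotopy moves (1)-(3),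
for the involution `τ` on `α`. -/
inductive Move (τ : α → α) : Phrase α → Phrase α → Prop
  | iso (f : ℕ → ℕ) (hf : Function.Injective f) (P : Phrase α) :
      Move τ P (rename f P)
  | h1 (P Q : Phrase α) (A : Letter α) (x y : List (Option (Letter α)))
      (hP : flat P = x ++ [some A, some A] ++ y)
      (hQ : flat Q = x ++ y) : Move τ P Q
  | h2 (P Q : Phrase α) (A B : Letter α) (x y z : List (Option (Letter α)))
      (hAB : B.2 = τ A.2)
      (hP : flat P = x ++ [some A, some B] ++ y ++ [some B, some A] ++ z)
      (hQ : flat Q = x ++ y ++ z) : Move τ P Q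
  | h3 (P Q : Phrase α) (A B C : Letter α) (x y z t : List (Option (Letter α)))
      (hAB : A.2 = B.2) (hBC : B.2 = C.2)
      (hP : flat P = x ++ [some A, some B] ++ y ++ [some A, some C] ++ z
              ++ [some B, some C] ++ t)
      (hQ : flat Q = x ++ [some B, some A] ++ y ++ [some C, some A] ++ z
              ++ [some C, some B] ++ t) : Move τ P Q

/-- A nanophrase over the subset `β`: a Gauss phrase all of whose letters project into `β`. -/
def NanoIn [DecidableEq α] (β : Set α) (P : Phrase α) : Prop := IsGauss P ∧ ProjIn β P

/-- Homotopy of nanophrases in the class of nanophrases over `β ⊆ α`: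
a finite chain of isomorphisms, moves (1)-(3) and their inverses, all whose
terms are nanophrases over `β`. -/
def HomotopicIn [DecidableEq α] (τ : α → α) (β : Set α) (P Q : Phrase α) : Prop :=
  Relation.ReflTransGen
    (fun X Y => (Move τ X Y ∨ Move τ Y X) ∧ NanoIn β X ∧ NanoIn β Y) P Q

/-- Homotopy of nanophrases over `α`. -/
def Homotopic [DecidableEq α] (τ : α → α) (P Q : Phrase α) : Prop :=
  HomotopicIn τ Set.univ P Q

/-! ### Desingularization -/

/-- The letter `A_{p,q}` of the desingularized alphabet. -/
def dLetter (A : Letter α) (p q : ℕ) : Letter α := (Nat.pair A.1 (Nat.pair p q), A.2)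

/-- The replacement of the `i`-th occurrence (1-indexed) of a letter `A` of
multiplicity `m`: `A_{1,i} A_{2,i} ⋯ A_{i-1,i} A_{i,i+1} ⋯ A_{i,m}`. -/
def repl (A : Letter α) (i m : ℕ) : List (Letter α) :=
  ((List.range (i - 1)).map fun j => dLetter A (j + 1) i) ++
  ((List.range (m - i)).map fun j => dLetter A i (i + j + 1))

def desingWord [DecidableEq α] (m : Letter α → ℕ) :
    List (Letter α) → (Letter α → ℕ) → List (Letter α)
  | [], _ => []
  | A :: rest, seen =>
      repl A (seen A + 1) (m A) ++
        desingWord m rest (fun B => if B = A then seen B + 1 else seen B)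

def desingAux [DecidableEq α] (m : Letter α → ℕ) :
    Phrase α → (Letter α → ℕ) → Phrase α
  | [], _ => []
  | w :: ws, seen => desingWord m w seen :: desingAux m ws (fun B => seen B + w.count B)

/-- The desingularization `P^d` of an étale phrase `P`. -/
def desing [DecidableEq α] (P : Phrase α) : Phrase α :=
  desingAux (fun A => P.flatten.count A) P (fun _ => 0)

/-- Homotopy of étale phrases: homotopy of their desingularizations. -/
def EHomotopic [DecidableEq α] (τ : α → α) (P Q : Phrase α) : Prop :=
  Homotopic τ (desing P) (desing Q)

/-! ### Phrases over `α` itself, via the identity projection -/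

/-- An element of `α` regarded as a letter (identity projection). -/
def ofα (a : α) : Letter α := (0, a)

/-- The empty phrase `(∅)_k` of length `k`. -/
def emptyP (k : ℕ) : Phrase α := List.replicate k []

/-- `P^{1,1;l₁,l₂}_a`. -/
def P11 (k : ℕ) (l1 l2 : Fin k) (a : α) : Phrase α :=
  List.ofFn fun i => if i = l1 ∨ i = l2 then [ofα a] else []

/-- `P^{3;l}_a`. -/
def P3 (k : ℕ) (l : Fin k) (a : α) : Phrase α :=
  List.ofFn fun i => if i = l then [ofα a, ofα a, ofα a] else []

/-- `P^{2,1;l₁,l₂}_a`. -/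
def P21 (k : ℕ) (l1 l2 : Fin k) (a : α) : Phrase α :=
  List.ofFn fun i => if i = l1 then [ofα a, ofα a] else if i = l2 then [ofα a] else []

/-- `P^{1,2;l₁,l₂}_a`. -/
def P12 (k : ℕ) (l1 l2 : Fin k) (a : α) : Phrase α :=
  List.ofFn fun i => if i = l1 then [ofα a] else if i = l2 then [ofα a, ofα a] else []

/-- `P^{1,1,1;l₁,l₂,l₃}_a`. -/
def P111 (k : ℕ) (l1 l2 l3 : Fin k) (a : α) : Phrase α :=
  List.ofFn fun i => if i = l1 ∨ i = l2 ∨ i = l3 then [ofα a] else []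


/-! ### The model phrases, indexed by their type and indices -/

/-- An index for the model phrases `P^{1,1;l₁,l₂}_a`, `P^{3;l}_a`, `P^{2,1;l₁,l₂}_a`,
`P^{1,2;l₁,l₂}_a`, `P^{1,1,1;l₁,l₂,l₃}_a` of length `k`. -/
inductive Model (k : ℕ) (α : Type*) where
  | m11 (l1 l2 : Fin k) (a : α)
  | m3 (l : Fin k) (a : α)
  | m21 (l1 l2 : Fin k) (a : α)
  | m12 (l1 l2 : Fin k) (a : α)
  | m111 (l1 l2 l3 : Fin k) (a : α)

variable {k : ℕ}

/-- Admissibility: the indices are strictly increasing, and `a ≠ τ(a)` for `P^{3;l}_a`. -/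
def Model.valid (τ : α → α) : Model k α → Prop
  | .m11 l1 l2 _ => l1 < l2
  | .m3 _ a => a ≠ τ a
  | .m21 l1 l2 _ => l1 < l2
  | .m12 l1 l2 _ => l1 < l2
  | .m111 l1 l2 l3 _ => l1 < l2 ∧ l2 < l3

/-- The étale phrase indexed by a model index. -/
def Model.toPhrase : Model k α → Phrase α
  | .m11 l1 l2 a => P11 k l1 l2 a
  | .m3 l a => P3 k l a
  | .m21 l1 l2 a => P21 k l1 l2 a
  | .m12 l1 l2 a => P12 k l1 l2 a
  | .m111 l1 l2 l3 a => P111 k l1 l2 l3 a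

/-- The letter of `α` used by a model phrase. -/
def Model.letter : Model k α → α
  | .m11 _ _ a => a
  | .m3 _ a => a
  | .m21 _ _ a => a
  | .m12 _ _ a => a
  | .m111 _ _ _ a => a

/-! ### Flattened phrases -/

theorem flat_nil : flat ([] : Phrase α) = [] := rfl

theorem flat_singleton (w : List (Letter α)) : flat [w] = w.map some := by
  simp [flat]

theorem flat_cons (w : List (Letter α)) {P : Phrase α} (hP : P ≠ []) :
    flat (w :: P) = w.map some ++ none :: flat P := by
  simp [flat, List.intercalate_cons_of_ne_nil, hP]

theorem reduceOption_map_some {β : Type*} (w : List β) :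
    (w.map some).reduceOption = w := by
  induction w with
  | nil => rfl
  | cons a w ih => simp [List.reduceOption_cons_of_some, ih]

theorem reduceOption_flat (P : Phrase α) : (flat P).reduceOption = P.flatten := by
  induction P with
  | nil => rfl
  | cons w P ih =>
    rcases eq_or_ne P [] with rfl | hP
    · simp [flat_singleton, reduceOption_map_some]
    · simp [flat_cons w hP, List.reduceOption_append, List.reduceOption_cons_of_none,
        reduceOption_map_some, ih]

theorem count_none_flat [DecidableEq α] {P : Phrase α} (hP : P ≠ []) :
    (flat P).count none + 1 = P.length := by
  induction P with
  | nil => exact absurd rfl hP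
  | cons w P ih =>
    rcases eq_or_ne P [] with rfl | hP
    · simp [flat_singleton, List.count_eq_zero]
    · have := ih hP
      have h0 : List.count none (List.map some w) = 0 := by simp [List.count_eq_zero]
      simp only [flat_cons w hP, List.count_append, h0, List.count_cons_self, List.length_cons]
      omega

theorem flat_injective [DecidableEq α] {P Q : Phrase α} (hP : P ≠ []) (hQ : Q ≠ [])
    (h : flat P = flat Q) : P = Q := by
  have key : ∀ R : Phrase α, R ≠ [] → (flat R).splitOn none = R.map (List.map some) := by
    intro R hR
    exact List.splitOn_intercalate none (by simp) (by simpa using hR)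
  have := (key P hP).symm.trans ((congrArg _ h).trans (key Q hQ))
  exact List.map_injective_iff.2 (List.map_injective_iff.2 (Option.some_injective _)) this

theorem exists_flat_eq (l : List (Option (Letter α))) : ∃ P : Phrase α, flat P = l := by
  suffices h : ∃ P : Phrase α, P ≠ [] ∧ flat P = l from h.imp fun _ h => h.2
  induction l with
  | nil => exact ⟨[[]], by simp, rfl⟩
  | cons o l ih =>
    obtain ⟨P, hP, rfl⟩ := ih
    cases o with
    | none => exact ⟨[] :: P, by simp, by simp [flat_cons _ hP]⟩
    | some A =>
      obtain ⟨w, Q, rfl⟩ := List.exists_cons_of_ne_nil hP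
      refine ⟨(A :: w) :: Q, by simp, ?_⟩
      rcases eq_or_ne Q [] with rfl | hQ
      · simp [flat_singleton]
      · simp [flat_cons _ hQ]

theorem flat_rename (f : ℕ → ℕ) (P : Phrase α) :
    flat (rename f P) = (flat P).map (Option.map fun A => (f A.1, A.2)) := by
  induction P with
  | nil => rfl
  | cons w P ih =>
    rcases eq_or_ne P [] with rfl | hP
    · simp [rename, flat_singleton]
    · have h2 : rename f P ≠ [] := by simpa [rename] using hP
      have h1 : rename f (w :: P) = w.map (fun A => (f A.1, A.2)) :: rename f P := rfl
      rw [h1, flat_cons _ h2, flat_cons _ hP, ih]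
      simp

/-- A flattened phrase in which every letter that occurs does so exactly twice. -/
def GaussList [DecidableEq α] (l : List (Option (Letter α))) : Prop :=
  ∀ A, some A ∈ l → l.count (some A) = 2

theorem count_reduceOption [DecidableEq α] (l : List (Option (Letter α))) (a : Letter α) :
    l.reduceOption.count a = l.count (some a) := by
  induction l with
  | nil => rfl
  | cons o l ih =>
    cases o with
    | none => simp [List.reduceOption_cons_of_none, ih]
    | some b => simp [List.reduceOption_cons_of_some, List.count_cons, ih]

theorem isGauss_iff [DecidableEq α] (P : Phrase α) : IsGauss P ↔ GaussList (flat P) := by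
  simp only [IsGauss, GaussList, ← reduceOption_flat, List.reduceOption_mem_iff,
    count_reduceOption]

theorem nanoIn_univ_iff [DecidableEq α] (P : Phrase α) :
    NanoIn Set.univ P ↔ GaussList (flat P) := by
  simp [NanoIn, isGauss_iff, ProjIn]

/-! ### Desingularization of flattened phrases -/

/-- The desingularization of a flattened phrase. -/
def desingFlat [DecidableEq α] (m : Letter α → ℕ) :
    List (Option (Letter α)) → (Letter α → ℕ) → List (Option (Letter α))
  | [], _ => []
  | none :: l, seen => none :: desingFlat m l seen
  | some A :: l, seen =>
      (repl A (seen A + 1) (m A)).map some ++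
        desingFlat m l (fun B => if B = A then seen B + 1 else seen B)

theorem desingFlat_map_some_append [DecidableEq α] (m : Letter α → ℕ) (w : List (Letter α))
    (l : List (Option (Letter α))) (seen : Letter α → ℕ) :
    desingFlat m (w.map some ++ l) seen =
      (desingWord m w seen).map some ++ desingFlat m l (fun B => seen B + w.count B) := by
  induction w generalizing seen with
  | nil => simp [desingWord]
  | cons A w ih =>
    simp only [List.map_cons, List.cons_append, desingFlat, ih, desingWord, List.map_append,
      List.append_assoc, List.append_cancel_left_eq]
    congr 1
    funext B
    by_cases h : B = A
    · subst h; simp; omega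
    · simp [h, Ne.symm h]

theorem flat_desingAux [DecidableEq α] (m : Letter α → ℕ) (P : Phrase α)
    (seen : Letter α → ℕ) : flat (desingAux m P seen) = desingFlat m (flat P) seen := by
  induction P generalizing seen with
  | nil => rfl
  | cons w P ih =>
    rcases eq_or_ne P [] with rfl | hP
    · have := desingFlat_map_some_append m w [] seen
      simp only [List.append_nil] at this
      simp [desingAux, flat_singleton, this, desingFlat]
    · have h2 : desingAux m P (fun B => seen B + w.count B) ≠ [] := by
        cases P <;> simp_all [desingAux]
      rw [desingAux, flat_cons _ h2, flat_cons _ hP, desingFlat_map_some_append, desingFlat, ih]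

theorem desingFlat_replicate_none_append [DecidableEq α] (m : Letter α → ℕ) (n : ℕ)
    (l : List (Option (Letter α))) (seen : Letter α → ℕ) :
    desingFlat m (List.replicate n none ++ l) seen =
      List.replicate n none ++ desingFlat m l seen := by
  induction n with
  | zero => simp
  | succ n ih => simp [List.replicate_succ, desingFlat, ih]

/-- The flattened phrase with two occurrences of `A`. -/
def twice (A : Letter α) (n₀ n₁ n₂ : ℕ) : List (Option (Letter α)) :=
  List.replicate n₀ none ++ some A :: (List.replicate n₁ none ++ some A ::
    (List.replicate n₂ none ++ []))

/-- The flattened phrase with three occurrences of `A`. -/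
def thrice (A : Letter α) (n₀ n₁ n₂ n₃ : ℕ) : List (Option (Letter α)) :=
  List.replicate n₀ none ++ some A :: (List.replicate n₁ none ++ some A ::
    (List.replicate n₂ none ++ some A :: (List.replicate n₃ none ++ [])))

/-- The flattened desingularization of a phrase with three occurrences of one letter. -/
def tripod (X Y Z : Letter α) (n₀ n₁ n₂ n₃ : ℕ) : List (Option (Letter α)) :=
  List.replicate n₀ none ++ some X :: some Y :: (List.replicate n₁ none ++ some X :: some Z ::
    (List.replicate n₂ none ++ some Y :: some Z :: (List.replicate n₃ none ++ [])))

theorem flat_desing_twice [DecidableEq α] {P : Phrase α} {A : Letter α} {n₀ n₁ n₂ : ℕ}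
    (h : flat P = twice A n₀ n₁ n₂) :
    flat (desing P) = twice (dLetter A 1 2) n₀ n₁ n₂ := by
  have hm : P.flatten.count A = 2 := by
    rw [← reduceOption_flat, count_reduceOption, h]
    simp [twice, List.count_replicate]
  rw [desing, flat_desingAux, h]
  simp only [twice, desingFlat_replicate_none_append, desingFlat, hm, repl]
  simp

theorem flat_desing_thrice [DecidableEq α] {P : Phrase α} {A : Letter α} {n₀ n₁ n₂ n₃ : ℕ}
    (h : flat P = thrice A n₀ n₁ n₂ n₃) :
    flat (desing P) =
      tripod (dLetter A 1 2) (dLetter A 1 3) (dLetter A 2 3) n₀ n₁ n₂ n₃ := by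
  have hm : P.flatten.count A = 3 := by
    rw [← reduceOption_flat, count_reduceOption, h]
    simp [thrice, List.count_replicate]
  rw [desing, flat_desingAux, h]
  simp only [thrice, tripod, desingFlat_replicate_none_append, desingFlat, hm, repl]
  simp [List.range_succ]

/-! ### Positions and linking of letters -/

section Invariant

variable [DecidableEq α]

/-- The list of components in which `A` occurs, the first component being numbered `n`. -/
def occ (A : Letter α) : List (Option (Letter α)) → ℕ → List ℕ
  | [], _ => []
  | none :: l, n => occ A l (n + 1)
  | some B :: l, n => if B = A then n :: occ A l n else occ A l n

theorem occ_append (A : Letter α) (x y : List (Option (Letter α))) (n : ℕ) :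
    occ A (x ++ y) n = occ A x n ++ occ A y (n + x.count none) := by
  induction x generalizing n with
  | nil => simp [occ]
  | cons o x ih =>
    cases o with
    | none => simp [occ, ih]; congr 1; omega
    | some B => by_cases h : B = A <;> simp [occ, ih, h]

theorem occ_eq_nil {A : Letter α} {x : List (Option (Letter α))} (h : some A ∉ x) (n : ℕ) :
    occ A x n = [] := by
  induction x generalizing n with
  | nil => rfl
  | cons o x ih =>
    cases o with
    | none => simp_all [occ]
    | some B =>
      have : B ≠ A := by rintro rfl; simp at h
      simp_all [occ]

/-- The subsequence formed by the occurrences of `A` and `B`. -/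
def restrict (A B : Letter α) (l : List (Option (Letter α))) : List (Option (Letter α)) :=
  l.filter fun o => o = some A ∨ o = some B

@[simp] theorem restrict_nil (A B : Letter α) : restrict A B [] = [] := rfl

@[simp] theorem restrict_append (A B : Letter α) (x y : List (Option (Letter α))) :
    restrict A B (x ++ y) = restrict A B x ++ restrict A B y := by
  simp [restrict]

theorem restrict_cons (A B C : Letter α) (x : List (Option (Letter α))) :
    restrict A B (some C :: x) =
      if C = A ∨ C = B then some C :: restrict A B x else restrict A B x := by
  by_cases h : C = A ∨ C = B <;> simp [restrict, h]

@[simp] theorem restrict_cons_none (A B : Letter α) (x : List (Option (Letter α))) :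
    restrict A B (none :: x) = restrict A B x := by
  simp [restrict]

theorem restrict_eq_nil {A B : Letter α} {x : List (Option (Letter α))} (hA : some A ∉ x)
    (hB : some B ∉ x) : restrict A B x = [] := by
  simp only [restrict, List.filter_eq_nil_iff, decide_eq_true_eq]
  rintro o ho (rfl | rfl)
  exacts [hA ho, hB ho]

theorem restrict_eq_replicate {A B : Letter α} {x : List (Option (Letter α))}
    (hB : some B ∉ x) : restrict A B x = List.replicate (x.count (some A)) (some A) := by
  induction x with
  | nil => rfl
  | cons o x ih =>
    simp only [List.mem_cons, not_or] at hB
    cases o with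
    | none => simpa using ih hB.2
    | some C =>
      by_cases h : C = A
      · subst h
        simp [restrict_cons, ih hB.2, List.replicate_succ]
      · have : C ≠ B := by rintro rfl; simp at hB
        simp [restrict_cons, ih hB.2, h, this]

theorem restrict_comm (A B : Letter α) (l : List (Option (Letter α))) :
    restrict A B l = restrict B A l := by
  simp only [restrict, or_comm]

/-- The linking sign of `A` with `B`: it is `1` or `-1` according as the two letters alternate
starting with `A` or with `B`, and `0` if they do not alternate. -/
def link (A B : Letter α) (l : List (Option (Letter α))) : ℤ :=
  if restrict A B l = [some A, some B, some A, some B] then 1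
  else if restrict A B l = [some B, some A, some B, some A] then -1 else 0

theorem link_congr {A B : Letter α} {l l' : List (Option (Letter α))}
    (h : restrict A B l = restrict A B l') : link A B l = link A B l' := by
  rw [link, link, h]

theorem link_swap {A B : Letter α} (h : A ≠ B) (l : List (Option (Letter α))) :
    link A B l = - link B A l := by
  rw [link, link, restrict_comm]
  split_ifs with h1 h2 <;> simp_all

theorem link_self {A : Letter α} {l : List (Option (Letter α))} (h : l.count (some A) ≤ 2) :
    link A A l = 0 := by
  have h1 : restrict A A l = List.replicate (l.count (some A)) (some A) := by
    simp [restrict, ← List.filter_eq]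
  have h2 : (restrict A A l).length ≤ 2 := by simp [h1, h]
  rw [link, if_neg, if_neg] <;> intro h3 <;> simp [h3] at h2

theorem link_eq_zero_of_adjacent {A D : Letter α} {x y : List (Option (Letter α))} (h : A ≠ D) :
    link D A (x ++ some A :: some A :: y) = 0 := by
  have key : ∀ p q : List (Option (Letter α)), ∀ E F : Letter α, E ≠ F →
      p ++ some A :: some A :: q ≠ [some E, some F, some E, some F] := by
    intro p q E F hEF h1
    have h2 : p.length + q.length = 2 := by
      have := congrArg List.length h1
      simp at this
      omega
    rcases p with _ | ⟨a, _ | ⟨b, _ | ⟨c, p⟩⟩⟩ <;> simp at h1 <;> grind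
  have h1 : restrict D A (x ++ some A :: some A :: y) =
      restrict D A x ++ some A :: some A :: restrict D A y := by simp [restrict_cons]
  rw [link, h1, if_neg (key _ _ _ _ h.symm), if_neg (key _ _ _ _ h)]

theorem link_eq_link_of_parallel {A B D : Letter α} {x y z l l' : List (Option (Letter α))}
    (hA : some A ∉ x ++ y ++ z) (hB : some B ∉ x ++ y ++ z) (hAD : A ≠ D) (hBD : B ≠ D)
    (hl : restrict D A l = restrict D A x ++ some A :: (restrict D A y ++ some A :: restrict D A z))
    (hl' : restrict D B l' =
      restrict D B x ++ some B :: (restrict D B y ++ some B :: restrict D B z)) :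
    link D A l = link D B l' := by
  simp only [List.mem_append, not_or] at hA hB
  rw [link, link, hl, hl', restrict_eq_replicate hA.1.1, restrict_eq_replicate hA.1.2,
    restrict_eq_replicate hA.2, restrict_eq_replicate hB.1.1, restrict_eq_replicate hB.1.2,
    restrict_eq_replicate hB.2]
  have key : ∀ E : Letter α, E ≠ D → ∀ p q r : ℕ,
      (List.replicate p (some D) ++ some E :: (List.replicate q (some D) ++ some E ::
        List.replicate r (some D)) = [some D, some E, some D, some E] ↔
          p = 1 ∧ q = 1 ∧ r = 0) ∧
      (List.replicate p (some D) ++ some E :: (List.replicate q (some D) ++ some E ::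
        List.replicate r (some D)) = [some E, some D, some E, some D] ↔
          p = 0 ∧ q = 1 ∧ r = 1) := by
    intro E hE p q r
    rcases p with _ | _ | p <;> rcases q with _ | _ | q <;> rcases r with _ | _ | r <;>
      simp [List.replicate_succ, hE, hE.symm]
  simp only [key A hAD, key B hBD]

/-- The set of letters occurring in a flattened phrase. -/
def letters (l : List (Option (Letter α))) : Finset (Letter α) := l.reduceOption.toFinset

@[simp] theorem mem_letters {l : List (Option (Letter α))} {A : Letter α} :
    A ∈ letters l ↔ some A ∈ l := by
  simp [letters, List.reduceOption_mem_iff]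

variable {G : Type*} [AddCommGroup G] (φ : α → G)

/-- The index of the letter `A`: the sum of its linking signs, weighted by `φ`. -/
def index (A : Letter α) (l : List (Option (Letter α))) : G :=
  ∑ B ∈ letters l, link A B l • φ B.2

open Classical in
/-- The sum of the weights of the letters with components `κ` and index `g`. -/
noncomputable def invariantSum (l : List (Option (Letter α))) (κ : List ℕ) (g : G) : G :=
  ∑ A ∈ letters l, if occ A l 0 = κ ∧ index φ A l = g then φ A.2 else 0

/-- The keys that do not see letters with adjacent occurrences. -/
def IsKey (κ : List ℕ) (g : G) : Prop := ∀ n, κ = [n, n] → g ≠ 0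

theorem invariantSum_map {F : Letter α → Letter α} (hF : Function.Injective F)
    (hF2 : ∀ A, (F A).2 = A.2) (l : List (Option (Letter α))) (κ : List ℕ) (g : G) :
    invariantSum φ (l.map (Option.map F)) κ g = invariantSum φ l κ g := by
  have hocc : ∀ A l n, occ (F A) (l.map (Option.map F)) n = occ A l n := by
    intro A l
    induction l with
    | nil => intro n; rfl
    | cons o l ih => intro n; cases o <;> simp [occ, ih, hF.eq_iff]
  have hres : ∀ A B l, restrict (F A) (F B) (l.map (Option.map F)) =
      (restrict A B l).map (Option.map F) := by
    intro A B l
    induction l with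
    | nil => rfl
    | cons o l ih =>
      cases o with
      | none => simpa using ih
      | some C =>
        simp only [List.map_cons, Option.map_some, restrict_cons, hF.eq_iff, ih]
        split_ifs <;> simp
  have hinj : Function.Injective (List.map (Option.map F)) :=
    List.map_injective_iff.2 (Option.map_injective hF)
  have hlink : ∀ A B, link (F A) (F B) (l.map (Option.map F)) = link A B l := by
    intro A B
    have h : ∀ C D, restrict (F A) (F B) (l.map (Option.map F)) =
        [some (F C), some (F D), some (F C), some (F D)] ↔
          restrict A B l = [some C, some D, some C, some D] := by
      intro C D
      rw [hres, ← hinj.eq_iff (b := [some C, some D, some C, some D])]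
      rfl
    simp only [link, h]
  have hletters : letters (l.map (Option.map F)) = (letters l).image F := by
    ext A
    simp only [mem_letters, List.mem_map, Finset.mem_image]
    constructor
    · rintro ⟨_ | B, h1, h2⟩
      · simp at h2
      · exact ⟨B, h1, by simpa using h2⟩
    · rintro ⟨B, h1, rfl⟩
      exact ⟨some B, h1, rfl⟩
  have hindex : ∀ A, index φ (F A) (l.map (Option.map F)) = index φ A l := by
    intro A
    simp only [index, hletters, Finset.sum_image hF.injOn, hlink, hF2]
  rw [invariantSum, invariantSum, hletters, Finset.sum_image hF.injOn]
  exact Finset.sum_congr rfl fun A _ => by rw [hocc, hindex, hF2]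

theorem invariantSum_eq_of_adjacent {A : Letter α} {x y : List (Option (Letter α))}
    (hg : GaussList (x ++ some A :: some A :: y)) {κ : List ℕ} {g : G} (hκ : IsKey κ g) :
    invariantSum φ (x ++ some A :: some A :: y) κ g = invariantSum φ (x ++ y) κ g := by
  have hc := hg A (by simp)
  simp only [List.count_append, List.count_cons_self] at hc
  have hx : some A ∉ x := by rw [← List.count_eq_zero]; omega
  have hy : some A ∉ y := by rw [← List.count_eq_zero]; omega
  have hl : letters (x ++ some A :: some A :: y) = insert A (letters (x ++ y)) := by
    ext D; simp; tauto
  have hA : A ∉ letters (x ++ y) := by simp [hx, hy]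
  have hlink : ∀ D ≠ A, ∀ E ≠ A,
      link D E (x ++ some A :: some A :: y) = link D E (x ++ y) := by
    intro D hD E hE
    apply link_congr
    simp [restrict_cons, hD.symm, hE.symm]
  have hindex : ∀ D ∈ letters (x ++ y),
      index φ D (x ++ some A :: some A :: y) = index φ D (x ++ y) := by
    intro D hD
    have hDA : D ≠ A := fun h => hA (h ▸ hD)
    rw [index, index, hl, Finset.sum_insert hA, link_eq_zero_of_adjacent hDA.symm, zero_smul,
      zero_add]
    exact Finset.sum_congr rfl fun E hE => by rw [hlink D hDA E fun h => hA (h ▸ hE)]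
  have hindexA : index φ A (x ++ some A :: some A :: y) = 0 := by
    refine Finset.sum_eq_zero fun E _ => ?_
    rcases eq_or_ne E A with rfl | hE
    · rw [link_self (hg E (by simp)).le, zero_smul]
    · rw [link_swap hE.symm, link_eq_zero_of_adjacent hE.symm, neg_zero, zero_smul]
  rw [invariantSum, invariantSum, hl, Finset.sum_insert hA, if_neg, zero_add]
  · refine Finset.sum_congr rfl fun D hD => ?_
    have hDA : A ≠ D := fun h => hA (h ▸ hD)
    rw [hindex D hD, show occ D (x ++ some A :: some A :: y) 0 = occ D (x ++ y) 0 by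
      simp [occ_append, occ, hDA]]
  · rintro ⟨h1, h2⟩
    refine hκ (x.count none) ?_ (h2.symm.trans hindexA)
    simp [← h1, occ_append, occ, occ_eq_nil hx, occ_eq_nil hy]

theorem invariantSum_eq_of_cancel {τ : α → α} (hφ : ∀ a, φ (τ a) = - φ a) {A B : Letter α}
    (hAB : B.2 = τ A.2) {x y z : List (Option (Letter α))}
    (hg : GaussList (x ++ some A :: some B :: (y ++ some B :: some A :: z)))
    (κ : List ℕ) (g : G) :
    invariantSum φ (x ++ some A :: some B :: (y ++ some B :: some A :: z)) κ g =
      invariantSum φ (x ++ (y ++ z)) κ g := by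
  have hcA := hg A (by simp)
  have hcB := hg B (by simp)
  have hselfA := link_self hcA.le
  have hselfB := link_self hcB.le
  have hne : A ≠ B := by
    rintro rfl
    simp only [List.count_append, List.count_cons_self] at hcA
    omega
  simp only [List.count_append, List.count_cons, beq_iff_eq, Option.some.injEq, hne, hne.symm,
    if_true, if_false] at hcA hcB
  have hxA : some A ∉ x := by rw [← List.count_eq_zero]; omega
  have hyA : some A ∉ y := by rw [← List.count_eq_zero]; omega
  have hzA : some A ∉ z := by rw [← List.count_eq_zero]; omega
  have hxB : some B ∉ x := by rw [← List.count_eq_zero]; omega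
  have hyB : some B ∉ y := by rw [← List.count_eq_zero]; omega
  have hzB : some B ∉ z := by rw [← List.count_eq_zero]; omega
  set l := x ++ some A :: some B :: (y ++ some B :: some A :: z) with hl
  set l' := x ++ (y ++ z) with hl'
  have hφAB : φ B.2 = - φ A.2 := by rw [hAB, hφ]
  have hB : B ∉ letters l' := by simp [hl', hxB, hyB, hzB]
  have hA : A ∉ insert B (letters l') := by simp [hl', hxA, hyA, hzA, hne]
  have hletters : letters l = insert A (insert B (letters l')) := by
    ext D; simp [hl, hl']; tauto
  have hlink : ∀ D ∈ letters l', ∀ E ∈ letters l', link D E l = link D E l' := by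
    intro D hD E hE
    have h1 : A ≠ D := by rintro rfl; simp_all
    have h2 : A ≠ E := by rintro rfl; simp_all
    have h3 : B ≠ D := by rintro rfl; simp_all
    have h4 : B ≠ E := by rintro rfl; simp_all
    apply link_congr
    simp [hl, hl', restrict_cons, h1, h2, h3, h4]
  have hlinkAB : ∀ D ∈ letters l', link D A l = link D B l := by
    intro D hD
    have h1 : A ≠ D := by rintro rfl; simp_all
    have h2 : B ≠ D := by rintro rfl; simp_all
    refine link_eq_link_of_parallel (x := x) (y := y) (z := z) ?_ ?_ h1 h2 ?_ ?_ <;>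
      simp [restrict_cons, hne.symm, *]
  have hindex : ∀ D ∈ letters l', index φ D l = index φ D l' := by
    intro D hD
    rw [index, index, hletters, Finset.sum_insert hA, Finset.sum_insert hB, hlinkAB D hD, hφAB,
      smul_neg, ← add_assoc, add_neg_cancel, zero_add]
    exact Finset.sum_congr rfl fun E hE => by rw [hlink D hD E hE]
  have hzero : link A B l = 0 := by
    have : restrict A B l = [some A, some B, some B, some A] := by
      simp [restrict_cons, restrict_eq_nil, *]
    simp [link, this, hne, hne.symm]
  have hindexAB : index φ A l = index φ B l := by
    have hzero' : link B A l = 0 := by rw [link_swap hne.symm, hzero, neg_zero]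
    rw [index, index, hletters]
    simp only [Finset.sum_insert hA, Finset.sum_insert hB, hzero, hzero', hselfA, hselfB,
      zero_smul, zero_add]
    refine Finset.sum_congr rfl fun D hD => ?_
    have h1 : A ≠ D := by rintro rfl; simp_all
    have h2 : B ≠ D := by rintro rfl; simp_all
    rw [link_swap h1, link_swap h2, hlinkAB D hD]
  have hocc : occ A l 0 = occ B l 0 := by
    simp [occ_append, occ, occ_eq_nil, hne.symm, *]
  rw [invariantSum, invariantSum, hletters, Finset.sum_insert hA, Finset.sum_insert hB, hindexAB,
    hocc, hφAB]
  have hcancel : ∀ (p : Prop) [Decidable p] (v s : G),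
      (if p then v else 0) + ((if p then -v else 0) + s) = s := by
    intro p _ v s; split_ifs <;> simp
  rw [hcancel]
  refine Finset.sum_congr rfl fun D hD => ?_
  have h1 : A ≠ D := by rintro rfl; simp_all
  have h2 : B ≠ D := by rintro rfl; simp_all
  rw [hindex D hD, show occ D l 0 = occ D l' 0 by simp [hl, hl', occ_append, occ, h1, h2]]

theorem invariantSum_eq_of_slide {A B C : Letter α} (hAB : A.2 = B.2) (hBC : B.2 = C.2)
    {x y z t : List (Option (Letter α))}
    (hg : GaussList (x ++ some A :: some B :: (y ++ some A :: some C ::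
      (z ++ some B :: some C :: t)))) (κ : List ℕ) (g : G) :
    invariantSum φ (x ++ some A :: some B :: (y ++ some A :: some C ::
      (z ++ some B :: some C :: t))) κ g =
    invariantSum φ (x ++ some B :: some A :: (y ++ some C :: some A ::
      (z ++ some C :: some B :: t))) κ g := by
  have hcA := hg A (by simp)
  have hcB := hg B (by simp)
  have hcC := hg C (by simp)
  have hne : A ≠ B := by
    rintro rfl
    simp only [List.count_append, List.count_cons_self] at hcA
    omega
  have hne2 : A ≠ C := by
    rintro rfl
    simp only [List.count_append, List.count_cons_self, List.count_cons] at hcA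
    omega
  have hne3 : B ≠ C := by
    rintro rfl
    simp only [List.count_append, List.count_cons_self, List.count_cons] at hcB
    omega
  simp only [List.count_append, List.count_cons, beq_iff_eq, Option.some.injEq, hne, hne.symm,
    hne2, hne2.symm, hne3, hne3.symm, if_true, if_false] at hcA hcB hcC
  have hxA : some A ∉ x := by rw [← List.count_eq_zero]; omega
  have hyA : some A ∉ y := by rw [← List.count_eq_zero]; omega
  have hzA : some A ∉ z := by rw [← List.count_eq_zero]; omega
  have htA : some A ∉ t := by rw [← List.count_eq_zero]; omega
  have hxB : some B ∉ x := by rw [← List.count_eq_zero]; omega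
  have hyB : some B ∉ y := by rw [← List.count_eq_zero]; omega
  have hzB : some B ∉ z := by rw [← List.count_eq_zero]; omega
  have htB : some B ∉ t := by rw [← List.count_eq_zero]; omega
  have hxC : some C ∉ x := by rw [← List.count_eq_zero]; omega
  have hyC : some C ∉ y := by rw [← List.count_eq_zero]; omega
  have hzC : some C ∉ z := by rw [← List.count_eq_zero]; omega
  have htC : some C ∉ t := by rw [← List.count_eq_zero]; omega
  set l := x ++ some A :: some B :: (y ++ some A :: some C :: (z ++ some B :: some C :: t))
    with hl
  set l' := x ++ some B :: some A :: (y ++ some C :: some A :: (z ++ some C :: some B :: t))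
    with hl'
  have hletters : letters l' = letters l := by
    ext D; simp [hl, hl']; tauto
  obtain ⟨S, hS, hA, hB, hC⟩ : ∃ S, letters l = insert A (insert B (insert C S)) ∧
      A ∉ S ∧ B ∉ S ∧ C ∉ S := by
    refine ⟨letters (x ++ y ++ z ++ t), ?_, ?_, ?_, ?_⟩
    · ext D; simp [hl]; tauto
    all_goals simp [*]
  have hlink : ∀ D ∈ letters l, ∀ E ∈ S, link D E l = link D E l' := by
    intro D hD E hE
    have h1 : A ≠ E := by rintro rfl; exact hA hE
    have h2 : B ≠ E := by rintro rfl; exact hB hE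
    have h3 : C ≠ E := by rintro rfl; exact hC hE
    apply link_congr
    by_cases h4 : A = D
    · subst h4; simp [hl, hl', restrict_cons, h1, h2, h3, hne.symm, hne2.symm]
    by_cases h5 : B = D
    · subst h5; simp [hl, hl', restrict_cons, h1, h2, h3, hne, hne3.symm]
    by_cases h6 : C = D
    · subst h6; simp [hl, hl', restrict_cons, h1, h2, h3, hne2, hne3]
    simp [hl, hl', restrict_cons, h1, h2, h3, h4, h5, h6]
  have hAS : A ∉ insert B (insert C S) := by simp [*]
  have hBS : B ∉ insert C S := by simp [*]
  have hself : ∀ D, D = A ∨ D = B ∨ D = C → link D D l = 0 ∧ link D D l' = 0 := by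
    rintro D (rfl | rfl | rfl) <;> constructor <;>
    simp [link, restrict_cons, restrict_eq_nil, *, hne.symm, hne2.symm, hne3.symm]
  have hlAB : link A B l = 1 ∧ link A B l' = 0 := by
    constructor <;>
    simp [link, restrict_cons, restrict_eq_nil, *, hne.symm, hne2.symm, hne3.symm]
  have hlAC : link A C l = 0 ∧ link A C l' = 1 := by
    constructor <;>
    simp [link, restrict_cons, restrict_eq_nil, *, hne.symm, hne2.symm, hne3.symm]
  have hlBC : link B C l = 1 ∧ link B C l' = 0 := by
    constructor <;>
    simp [link, restrict_cons, restrict_eq_nil, *, hne3.symm]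
  have hindex : ∀ D ∈ letters l, index φ D l' = index φ D l := by
    intro D hD
    rw [index, index, hletters, hS]
    simp only [Finset.sum_insert hAS, Finset.sum_insert hBS, Finset.sum_insert hC,
      ← add_assoc]
    congr 1
    · rw [hS] at hD
      simp only [Finset.mem_insert] at hD
      rcases hD with rfl | rfl | rfl | hD
      · simp [hlAB, hlAC, hself, hAB, hBC]
      · rw [link_swap hne.symm, link_swap hne.symm]
        simp [hlAB, hlBC, hself, hAB, hBC]
      · rw [link_swap hne2.symm, link_swap hne2.symm, link_swap hne3.symm, link_swap hne3.symm]
        simp [hlAC, hlBC, hself, hAB, hBC]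
      · have h1 : A ≠ D := by rintro rfl; exact hA hD
        have h2 : B ≠ D := by rintro rfl; exact hB hD
        have h3 : C ≠ D := by rintro rfl; exact hC hD
        simp only [link_swap h1.symm, link_swap h2.symm, link_swap h3.symm]
        rw [hlink A (by simp [hS]) D hD, hlink B (by simp [hS]) D hD,
          hlink C (by simp [hS]) D hD]
    · exact Finset.sum_congr rfl fun E hE => by rw [hlink D hD E hE]
  rw [invariantSum, invariantSum, hletters]
  refine Finset.sum_congr rfl fun D hD => ?_
  have hocc : occ D l' 0 = occ D l 0 := by
    by_cases h1 : A = D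
    · subst h1; simp [hl, hl', occ_append, occ, hne.symm, hne2.symm]
    by_cases h2 : B = D
    · subst h2; simp [hl, hl', occ_append, occ, h1, hne3.symm]
    by_cases h3 : C = D
    · subst h3; simp [hl, hl', occ_append, occ, h1, h2]
    simp [hl, hl', occ_append, occ, h1, h2, h3]
  rw [hindex D hD, hocc]

theorem Move.invariantSum_eq {τ : α → α} (hφ : ∀ a, φ (τ a) = - φ a) {P Q : Phrase α}
    (h : Move τ P Q) (hP : GaussList (flat P)) {κ : List ℕ} {g : G} (hκ : IsKey κ g) :
    invariantSum φ (flat P) κ g = invariantSum φ (flat Q) κ g := by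
  cases h with
  | iso f hf =>
    rw [flat_rename, invariantSum_map φ (F := fun A => (f A.1, A.2)) _ (fun _ => rfl)]
    rintro ⟨m, a⟩ ⟨n, b⟩ h
    simpa [hf.eq_iff] using h
  | h1 _ _ A x y h1 h2 =>
    rw [h1] at hP ⊢
    rw [h2]
    simp only [List.append_assoc, List.cons_append, List.nil_append] at hP ⊢
    exact invariantSum_eq_of_adjacent φ hP hκ
  | h2 _ _ A B x y z hAB h1 h2 =>
    rw [h1] at hP ⊢
    rw [h2]
    simp only [List.append_assoc, List.cons_append, List.nil_append] at hP ⊢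
    exact invariantSum_eq_of_cancel φ hφ hAB hP κ g
  | h3 _ _ A B C x y z t hAB hBC h1 h2 =>
    rw [h1] at hP ⊢
    rw [h2]
    simp only [List.append_assoc, List.cons_append, List.nil_append] at hP ⊢
    exact invariantSum_eq_of_slide φ hAB hBC hP κ g

theorem Homotopic.invariantSum_eq {τ : α → α} (hφ : ∀ a, φ (τ a) = - φ a) {P Q : Phrase α}
    (h : Homotopic τ P Q) {κ : List ℕ} {g : G} (hκ : IsKey κ g) :
    invariantSum φ (flat P) κ g = invariantSum φ (flat Q) κ g := by
  induction h with
  | refl => rfl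
  | tail _ h ih =>
    rw [ih]
    obtain ⟨h | h, hX, hY⟩ := h
    · exact h.invariantSum_eq φ hφ ((nanoIn_univ_iff _).1 hX) hκ
    · exact (h.invariantSum_eq φ hφ ((nanoIn_univ_iff _).1 hY) hκ).symm

open Classical in
theorem invariantSum_twice (A : Letter α) (n₀ n₁ n₂ : ℕ) (κ : List ℕ) (g : G) :
    invariantSum φ (twice A n₀ n₁ n₂) κ g =
      if κ = [n₀, n₀ + n₁] ∧ g = 0 then φ A.2 else 0 := by
  have hl : letters (twice A n₀ n₁ n₂) = {A} := by
    ext D; simp [twice, List.mem_replicate, eq_comm]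
  have hr : ∀ B n, restrict A B (List.replicate n none) = [] := fun B n =>
    restrict_eq_nil (by simp [List.mem_replicate]) (by simp [List.mem_replicate])
  have hi : index φ A (twice A n₀ n₁ n₂) = 0 := by
    simp [index, link, twice, hr, restrict_cons]
  have ho : occ A (twice A n₀ n₁ n₂) 0 = [n₀, n₀ + n₁] := by
    have : ∀ n m, occ A (List.replicate n none) m = [] := fun n m =>
      occ_eq_nil (by simp [List.mem_replicate]) _
    simp [twice, occ_append, occ, this]
  rw [invariantSum, hl, Finset.sum_singleton, hi, ho]
  simp only [eq_comm]

open Classical in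
theorem invariantSum_tripod {X Y Z : Letter α} (hXY : X ≠ Y) (hXZ : X ≠ Z) (hYZ : Y ≠ Z)
    (hX2 : X.2 = Z.2) (hY2 : Y.2 = Z.2) (n₀ n₁ n₂ n₃ : ℕ) (κ : List ℕ) (g : G) :
    invariantSum φ (tripod X Y Z n₀ n₁ n₂ n₃) κ g =
      (if κ = [n₀, n₀ + n₁] ∧ g = φ Z.2 then φ Z.2 else 0) +
      (if κ = [n₀, n₀ + n₁ + n₂] ∧ g = 0 then φ Z.2 else 0) +
      (if κ = [n₀ + n₁, n₀ + n₁ + n₂] ∧ g = - φ Z.2 then φ Z.2 else 0) := by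
  have hl : letters (tripod X Y Z n₀ n₁ n₂ n₃) = {X, Y, Z} := by
    ext D
    simp only [tripod, mem_letters, List.mem_append, List.mem_cons, List.mem_replicate,
      Option.some.injEq, Finset.mem_insert, Finset.mem_singleton, reduceCtorEq, and_false,
      List.not_mem_nil]
    tauto
  have hsum : ∀ f : Letter α → G,
      ∑ D ∈ letters (tripod X Y Z n₀ n₁ n₂ n₃), f D = f X + f Y + f Z := by
    intro f
    rw [hl, Finset.sum_insert (by simp [hXY, hXZ]), Finset.sum_insert (by simp [hYZ]),
      Finset.sum_singleton, add_assoc]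
  have hr : ∀ (A B : Letter α) n, restrict A B (List.replicate n none) = [] := fun A B n =>
    restrict_eq_nil (by simp [List.mem_replicate]) (by simp [List.mem_replicate])
  have ho' : ∀ (A : Letter α) n m, occ A (List.replicate n none) m = [] := fun A n m =>
    occ_eq_nil (by simp [List.mem_replicate]) _
  have hiX : index φ X (tripod X Y Z n₀ n₁ n₂ n₃) = φ Z.2 := by
    rw [index, hsum]
    simp [link, tripod, hr, restrict_cons, hXY, hXY.symm, hXZ, hXZ.symm, hYZ, hYZ.symm, hX2, hY2]
  have hiY : index φ Y (tripod X Y Z n₀ n₁ n₂ n₃) = 0 := by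
    rw [index, hsum]
    simp [link, tripod, hr, restrict_cons, hXY, hXY.symm, hXZ, hXZ.symm, hYZ, hYZ.symm, hX2, hY2]
  have hiZ : index φ Z (tripod X Y Z n₀ n₁ n₂ n₃) = - φ Z.2 := by
    rw [index, hsum]
    simp [link, tripod, hr, restrict_cons, hXY, hXY.symm, hXZ, hXZ.symm, hYZ, hYZ.symm, hX2, hY2]
  have hoX : occ X (tripod X Y Z n₀ n₁ n₂ n₃) 0 = [n₀, n₀ + n₁] := by
    simp [tripod, occ_append, occ, ho', hXY.symm, hXZ.symm]
  have hoY : occ Y (tripod X Y Z n₀ n₁ n₂ n₃) 0 = [n₀, n₀ + n₁ + n₂] := by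
    simp [tripod, occ_append, occ, ho', hXY, hYZ.symm, add_assoc]
  have hoZ : occ Z (tripod X Y Z n₀ n₁ n₂ n₃) 0 = [n₀ + n₁, n₀ + n₁ + n₂] := by
    simp [tripod, occ_append, occ, ho', hXZ, hYZ, add_assoc]
  rw [invariantSum, hsum, hiX, hiY, hiZ, hoX, hoY, hoZ, hX2, hY2]
  simp only [eq_comm]

end Invariant

/-! ### The weights -/

/-- Weights in an abelian group on which `τ` acts as negation. -/
def weight [DecidableEq α] (τ : α → α) (a : α) : α → ZMod 4 :=
  if τ a = a then Pi.single a 2 else Pi.single a 1 - Pi.single (τ a) 1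

theorem weight_map [DecidableEq α] {τ : α → α} (hτ : Function.Involutive τ) (a : α) :
    weight τ (τ a) = - weight τ a := by
  by_cases h : τ a = a
  · have : (2 : ZMod 4) = -2 := by decide
    simp only [weight, h, if_true, ← Pi.single_neg, ← this]
  · have h' : a ≠ τ a := Ne.symm h
    simp [weight, hτ a, h, h']

theorem weight_ne_zero [DecidableEq α] (τ : α → α) (a : α) : weight τ a ≠ 0 := by
  intro h
  have := congrFun h a
  by_cases h' : τ a = a
  · simp [weight, h'] at this
    exact absurd this (by decide)
  · simp [weight, h', Ne.symm h'] at this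
    exact absurd this (by decide)

theorem weight_injective [DecidableEq α] {τ : α → α} (hτ : Function.Involutive τ) :
    Function.Injective (weight τ) := by
  intro a b h
  by_contra hab
  have h1 := congrFun h a
  have e0 : (1 : ZMod 4) ≠ 0 := by decide
  have e1 : (2 : ZMod 4) ≠ 0 := by decide
  have e2 : (1 : ZMod 4) ≠ -1 := by decide
  by_cases ha : τ a = a <;> by_cases hb : τ b = b
  · simp [weight, ha, hb, hab, e1] at h1
  · have : τ b ≠ a := by rintro rfl; exact hb (by rw [← ha, hτ])
    simp [weight, ha, hb, hab, this.symm, e1] at h1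
  · simp [weight, ha, hb, hab, Ne.symm ha, e0] at h1
  · by_cases hba : a = τ b
    · subst hba
      have hb' : b ≠ τ b := Ne.symm hb
      simp [weight, hb, hb', hτ b, e2] at h1
    · simp [weight, ha, hb, hab, hba, Ne.symm ha, e0] at h1

/-! ### Shapes of flattened phrases with one letter -/

theorem eq_replicate_of_reduceOption_eq_nil {l : List (Option (Letter α))}
    (h : l.reduceOption = []) : ∃ n, l = List.replicate n none := by
  refine ⟨l.length, List.eq_replicate_of_mem fun o ho => ?_⟩
  cases o with
  | none => rfl
  | some A => simpa [h] using List.reduceOption_mem_iff.2 ho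

theorem eq_append_of_reduceOption_eq_cons {l : List (Option (Letter α))} {A : Letter α}
    {w : List (Letter α)} (h : l.reduceOption = A :: w) :
    ∃ n l', l = List.replicate n none ++ some A :: l' ∧ l'.reduceOption = w := by
  induction l with
  | nil => simp at h
  | cons o l ih =>
    cases o with
    | none =>
      rw [List.reduceOption_cons_of_none] at h
      obtain ⟨n, l', rfl, hw⟩ := ih h
      exact ⟨n + 1, l', by simp [List.replicate_succ], hw⟩
    | some B =>
      rw [List.reduceOption_cons_of_some, List.cons.injEq] at h
      exact ⟨0, l, by simp [h.1], h.2⟩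

theorem exists_eq_twice {l : List (Option (Letter α))} {A : Letter α}
    (h : l.reduceOption = [A, A]) : ∃ n₀ n₁ n₂, l = twice A n₀ n₁ n₂ := by
  obtain ⟨n₀, l₁, rfl, h₁⟩ := eq_append_of_reduceOption_eq_cons h
  obtain ⟨n₁, l₂, rfl, h₂⟩ := eq_append_of_reduceOption_eq_cons h₁
  obtain ⟨n₂, rfl⟩ := eq_replicate_of_reduceOption_eq_nil h₂
  exact ⟨n₀, n₁, n₂, by simp [twice]⟩

theorem exists_eq_thrice {l : List (Option (Letter α))} {A : Letter α}
    (h : l.reduceOption = [A, A, A]) : ∃ n₀ n₁ n₂ n₃, l = thrice A n₀ n₁ n₂ n₃ := by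
  obtain ⟨n₀, l₁, rfl, h₁⟩ := eq_append_of_reduceOption_eq_cons h
  obtain ⟨n₁, l₂, rfl, h₂⟩ := eq_append_of_reduceOption_eq_cons h₁
  obtain ⟨n₂, l₃, rfl, h₃⟩ := eq_append_of_reduceOption_eq_cons h₂
  obtain ⟨n₃, rfl⟩ := eq_replicate_of_reduceOption_eq_nil h₃
  exact ⟨n₀, n₁, n₂, n₃, by simp [thrice]⟩

theorem dLetter_ne (A : Letter α) {p q p' q' : ℕ} (h : ¬ (p = p' ∧ q = q')) :
    dLetter A p q ≠ dLetter A p' q' := by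
  simpa [dLetter, Nat.pair_eq_pair] using h

section

variable [DecidableEq α]

theorem count_none_twice (A : Letter α) (n₀ n₁ n₂ : ℕ) :
    (twice A n₀ n₁ n₂).count none = n₀ + n₁ + n₂ := by
  simp [twice]; omega

theorem count_none_thrice (A : Letter α) (n₀ n₁ n₂ n₃ : ℕ) :
    (thrice A n₀ n₁ n₂ n₃).count none = n₀ + n₁ + n₂ + n₃ := by
  simp [thrice]; omega

theorem occ_replicate (A : Letter α) (n m : ℕ) : occ A (List.replicate n none) m = [] :=
  occ_eq_nil (by simp [List.mem_replicate]) _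

theorem occ_twice (A : Letter α) (n₀ n₁ n₂ : ℕ) :
    occ A (twice A n₀ n₁ n₂) 0 = [n₀, n₀ + n₁] := by
  simp [twice, occ_append, occ, occ_replicate]

theorem occ_thrice (A : Letter α) (n₀ n₁ n₂ n₃ : ℕ) :
    occ A (thrice A n₀ n₁ n₂ n₃) 0 = [n₀, n₀ + n₁, n₀ + n₁ + n₂] := by
  simp [thrice, occ_append, occ, occ_replicate]

/-! ### Homotopic phrases with one letter -/

theorem EHomotopic.weight_sum_eq {τ : α → α} (hτ : Function.Involutive τ) {P Q : Phrase α}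
    (h : EHomotopic τ P Q) {κ : List ℕ} {g : α → ZMod 4} (hκ : IsKey κ g) :
    invariantSum (weight τ) (flat (desing P)) κ g =
      invariantSum (weight τ) (flat (desing Q)) κ g :=
  Homotopic.invariantSum_eq (weight τ) (weight_map hτ) h hκ

theorem isKey_of_ne {G : Type*} [AddCommGroup G] {i j : ℕ} (h : i ≠ j) (g : G) :
    IsKey [i, j] g := by
  intro n hn
  simp only [List.cons.injEq] at hn
  omega

theorem isKey_of_ne_zero {G : Type*} [AddCommGroup G] (κ : List ℕ) {g : G} (h : g ≠ 0) :
    IsKey κ g :=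
  fun _ _ => h

open Classical in
theorem invariantSum_desing_twice {G : Type*} [AddCommGroup G] (φ : α → G) {P : Phrase α}
    {A : Letter α} {n₀ n₁ n₂ : ℕ} (h : flat P = twice A n₀ n₁ n₂) (κ : List ℕ) (g : G) :
    invariantSum φ (flat (desing P)) κ g = if κ = [n₀, n₀ + n₁] ∧ g = 0 then φ A.2 else 0 := by
  rw [flat_desing_twice h, invariantSum_twice]
  rfl

open Classical in
theorem invariantSum_desing_thrice {G : Type*} [AddCommGroup G] (φ : α → G) {P : Phrase α}
    {A : Letter α} {n₀ n₁ n₂ n₃ : ℕ} (h : flat P = thrice A n₀ n₁ n₂ n₃) (κ : List ℕ) (g : G) :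
    invariantSum φ (flat (desing P)) κ g =
      (if κ = [n₀, n₀ + n₁] ∧ g = φ A.2 then φ A.2 else 0) +
      (if κ = [n₀, n₀ + n₁ + n₂] ∧ g = 0 then φ A.2 else 0) +
      (if κ = [n₀ + n₁, n₀ + n₁ + n₂] ∧ g = - φ A.2 then φ A.2 else 0) := by
  have h1 : dLetter A 1 2 ≠ dLetter A 1 3 := dLetter_ne A (by simp)
  have h2 : dLetter A 1 2 ≠ dLetter A 2 3 := dLetter_ne A (by simp)
  have h3 : dLetter A 1 3 ≠ dLetter A 2 3 := dLetter_ne A (by simp)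
  rw [flat_desing_thrice h, invariantSum_tripod φ h1 h2 h3 rfl rfl]
  rfl

theorem EHomotopic.eq_of_twice {τ : α → α} (hτ : Function.Involutive τ) {P Q : Phrase α}
    (h : EHomotopic τ P Q) {A B : Letter α} {n₀ n₁ n₂ m₀ m₁ m₂ : ℕ}
    (hP : flat P = twice A n₀ n₁ n₂) (hQ : flat Q = twice B m₀ m₁ m₂) (hn : 0 < n₁) :
    A.2 = B.2 ∧ n₀ = m₀ ∧ n₁ = m₁ := by
  have key := h.weight_sum_eq hτ (isKey_of_ne (show n₀ ≠ n₀ + n₁ by omega) 0)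
  rw [invariantSum_desing_twice _ hP, invariantSum_desing_twice _ hQ] at key
  have hA := weight_ne_zero τ A.2
  split_ifs at key with h1 h2 h2
  · have := weight_injective hτ key
    simp at h2
    exact ⟨this, by omega⟩
  · exact absurd key hA
  all_goals simp at h1

theorem EHomotopic.not_twice_thrice {τ : α → α} (hτ : Function.Involutive τ) {P Q : Phrase α}
    (h : EHomotopic τ P Q) {A B : Letter α} {n₀ n₁ n₂ m₀ m₁ m₂ m₃ : ℕ}
    (hP : flat P = twice A n₀ n₁ n₂) (hQ : flat Q = thrice B m₀ m₁ m₂ m₃) (hn : 0 < n₁) :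
    False := by
  have hA := weight_ne_zero τ A.2
  have hB := weight_ne_zero τ B.2
  by_cases hm : m₁ + m₂ = 0
  · have key := h.weight_sum_eq hτ (isKey_of_ne (show n₀ ≠ n₀ + n₁ by omega) 0)
    rw [invariantSum_desing_twice _ hP, invariantSum_desing_thrice _ hQ] at key
    obtain ⟨rfl, rfl⟩ : m₁ = 0 ∧ m₂ = 0 := by omega
    rw [if_pos (by simp), if_neg (by simp [hB.symm]), if_neg (by simp; omega),
      if_neg (by simp [hB])] at key
    simp [hA] at key
  · have key := h.weight_sum_eq hτ (isKey_of_ne_zero [m₀, m₀ + m₁] hB)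
    rw [invariantSum_desing_twice _ hP, invariantSum_desing_thrice _ hQ] at key
    have h3 : ¬ (m₁ = 0 ∧ m₂ = 0) := by omega
    simp only [hB, and_false, if_false, and_self, if_true] at key
    rw [if_neg] at key
    · simp [hB.symm] at key
    · simp; omega

theorem EHomotopic.eq_of_thrice_of_pos {τ : α → α} (hτ : Function.Involutive τ) {P Q : Phrase α}
    (h : EHomotopic τ P Q) {A B : Letter α} {n₀ n₁ n₂ n₃ m₀ m₁ m₂ m₃ : ℕ}
    (hP : flat P = thrice A n₀ n₁ n₂ n₃) (hQ : flat Q = thrice B m₀ m₁ m₂ m₃)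
    (hn : n₁ + n₂ ≠ 0) :
    A.2 = B.2 ∧ n₀ = m₀ ∧ n₁ = m₁ ∧ n₂ = m₂ := by
  have hA := weight_ne_zero τ A.2
  have hB := weight_ne_zero τ B.2
  have key1 := h.weight_sum_eq hτ (isKey_of_ne (show n₀ ≠ n₀ + n₁ + n₂ by omega) 0)
  have key2 := h.weight_sum_eq hτ (isKey_of_ne_zero [n₀, n₀ + n₁] hA)
  have key3 := h.weight_sum_eq hτ
    (isKey_of_ne_zero [n₀ + n₁, n₀ + n₁ + n₂] (neg_ne_zero.2 hA))
  simp only [invariantSum_desing_thrice _ hP, invariantSum_desing_thrice _ hQ] at key1 key2 key3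
  obtain ⟨hAB, h0, h12⟩ : A.2 = B.2 ∧ n₀ = m₀ ∧ n₁ + n₂ = m₁ + m₂ := by
    simp only [hA.symm, hB.symm, (neg_ne_zero.2 hA).symm, (neg_ne_zero.2 hB).symm, and_false,
      if_false, and_self, if_true, zero_add, add_zero] at key1
    split_ifs at key1 with h2
    · have := weight_injective hτ key1
      simp at h2
      exact ⟨this, by omega⟩
    · exact absurd key1 hA
  rw [← hAB] at key2 key3
  have hn1 : n₁ = m₁ := by
    by_contra hne
    have e : ∀ {a b c d : ℕ} {p : Prop}, ¬ (a = c ∧ b = d) → ¬ ([a, b] = [c, d] ∧ p) :=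
      fun h hp => h (by simpa using hp.1)
    rw [if_pos (by simp), if_neg (by simp [hA]), if_neg (e (by omega)), if_neg (e (by omega)),
      if_neg (by simp [hA])] at key2
    split_ifs at key2 with h4
    · have h5 : m₁ = 0 ∧ n₂ = 0 := by
        have := h4.1
        simp only [List.cons.injEq] at this
        omega
      rw [if_neg (e (by omega)), if_neg (by simp [hA]), if_pos (by simp), if_neg (e (by omega)),
        if_neg (by simp [hA]), if_neg (e (by omega))] at key3
      simp [hA] at key3
    · simp [hA] at key2
  exact ⟨hAB, h0, hn1, by omega⟩

theorem EHomotopic.eq_of_thrice {τ : α → α} (hτ : Function.Involutive τ) {P Q : Phrase α}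
    (h : EHomotopic τ P Q) {A B : Letter α} {n₀ n₁ n₂ n₃ m₀ m₁ m₂ m₃ : ℕ}
    (hP : flat P = thrice A n₀ n₁ n₂ n₃) (hQ : flat Q = thrice B m₀ m₁ m₂ m₃)
    (hn : n₁ + n₂ = 0 → A.2 ≠ τ A.2) (hQP : EHomotopic τ Q P) :
    A.2 = B.2 ∧ n₀ = m₀ ∧ n₁ = m₁ ∧ n₂ = m₂ := by
  by_cases hn' : n₁ + n₂ = 0
  · by_cases hm' : m₁ + m₂ = 0
    · obtain ⟨rfl, rfl⟩ : n₁ = 0 ∧ n₂ = 0 := by omega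
      obtain ⟨rfl, rfl⟩ : m₁ = 0 ∧ m₂ = 0 := by omega
      have hA := weight_ne_zero τ A.2
      have hne : weight τ A.2 ≠ - weight τ A.2 := by
        rw [← weight_map hτ]
        exact fun e => hn rfl (weight_injective hτ e)
      have key := h.weight_sum_eq hτ (isKey_of_ne_zero [n₀, n₀] hA)
      simp only [invariantSum_desing_thrice _ hP, invariantSum_desing_thrice _ hQ, add_zero, hA,
        hne, and_false, if_false, and_self, if_true] at key
      split_ifs at key with h1 h2 h2
      · exact absurd (h1.2.trans (neg_eq_iff_eq_neg.1 h2.2.symm) ) (by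
          rw [h1.2] at hne; exact fun _ => hne (h1.2.symm.trans h2.2))
      · exact ⟨weight_injective hτ h1.2, by simpa using h1.1, rfl, rfl⟩
      · exact ⟨weight_injective hτ (by simpa using key), by simpa using h2.1, rfl, rfl⟩
      · exact absurd (by simpa using key) hA
    · obtain ⟨-, -, h1, h2⟩ := hQP.eq_of_thrice_of_pos hτ hQ hP hm'
      omega
  · exact h.eq_of_thrice_of_pos hτ hP hQ hn'

end

/-! ### Components of occurrences in the model phrases -/

theorem getD_ofFn (f : Fin k → List (Letter α)) (i : ℕ) :
    (List.ofFn f).getD i [] = if h : i < k then f ⟨i, h⟩ else [] := by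
  by_cases h : i < k <;> simp [List.getD_eq_getElem?_getD, h]

theorem Model.length_toPhrase (M : Model k α) : M.toPhrase.length = k := by
  cases M <;> simp [toPhrase, P11, P3, P21, P12, P111]

theorem Model.eq_letter (M : Model k α) : ∀ w ∈ M.toPhrase, ∀ B ∈ w, B = ofα M.letter := by
  cases M <;> simp only [toPhrase, letter, P11, P3, P21, P12, P111, List.mem_ofFn] <;>
    rintro w ⟨i, rfl⟩ B hB <;> split_ifs at hB <;> simp_all

section

variable [DecidableEq α]

theorem le_of_mem_occ {A : Letter α} {l : List (Option (Letter α))} {n i : ℕ}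
    (h : i ∈ occ A l n) : n ≤ i := by
  induction l generalizing n with
  | nil => simp [occ] at h
  | cons o l ih =>
    cases o with
    | none => exact (Nat.le_succ n).trans (ih h)
    | some B =>
      by_cases hB : B = A
      · simp only [occ, hB, if_true, List.mem_cons] at h
        exact h.elim (fun h => h.ge) ih
      · simp only [occ, hB, if_false] at h
        exact ih h

theorem pairwise_occ (A : Letter α) (l : List (Option (Letter α))) (n : ℕ) :
    (occ A l n).Pairwise (· ≤ ·) := by
  induction l generalizing n with
  | nil => simp [occ]
  | cons o l ih =>
    cases o with
    | none => exact ih _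
    | some B =>
      by_cases hB : B = A
      · simpa only [occ, hB, if_true, List.pairwise_cons] using
          ⟨fun i hi => le_of_mem_occ hi, ih n⟩
      · simpa only [occ, hB, if_false] using ih n

theorem length_occ (A : Letter α) (l : List (Option (Letter α))) (n : ℕ) :
    (occ A l n).length = l.count (some A) := by
  induction l generalizing n with
  | nil => rfl
  | cons o l ih =>
    cases o with
    | none => simp [occ, ih]
    | some B => by_cases hB : B = A <;> simp [occ, hB, ih]

theorem occ_map_some (A : Letter α) (w : List (Letter α)) (n : ℕ) :
    occ A (w.map some) n = List.replicate (w.count A) n := by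
  induction w with
  | nil => rfl
  | cons B w ih => by_cases hB : B = A <;> simp [occ, hB, ih, List.replicate_succ]

theorem count_occ_flat (A : Letter α) (P : Phrase α) (n i : ℕ) :
    (occ A (flat P) n).count (n + i) = (P.getD i []).count A := by
  have hlow : ∀ (l : List (Option (Letter α))) (n : ℕ), (occ A l (n + 1)).count n = 0 :=
    fun l n => List.count_eq_zero.2 fun h => absurd (le_of_mem_occ h) (by omega)
  induction P generalizing n i with
  | nil => simp [flat_nil, occ]
  | cons w P ih =>
    rcases eq_or_ne P [] with rfl | hP
    · rw [flat_singleton, occ_map_some]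
      cases i <;> simp [List.count_replicate]
    · have hw : (w.map some).count none = 0 := by simp [List.count_eq_zero]
      rw [flat_cons w hP, occ_append, occ_map_some, hw, occ, List.count_append,
        List.count_replicate]
      cases i with
      | zero => simp [hlow]
      | succ i =>
        rw [← add_assoc, add_right_comm, add_zero, ih, if_neg (by simp; omega)]
        simp

theorem occ_flat_eq {A : Letter α} {P : Phrase α} {κ : List ℕ} (hκ : κ.Pairwise (· ≤ ·))
    (h : ∀ i, (P.getD i []).count A = κ.count i) : occ A (flat P) 0 = κ := by
  refine List.Perm.eq_of_pairwise' (pairwise_occ A _ _) hκ (List.perm_iff_count.2 fun i => ?_)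
  have := count_occ_flat A P 0 i
  rw [zero_add] at this
  rw [this, h]

theorem ne_nil_of_occ {A : Letter α} {P : Phrase α} (hocc : occ A (flat P) 0 ≠ []) :
    P ≠ [] := by
  rintro rfl
  exact hocc rfl

theorem flatten_eq_replicate {A : Letter α} {P : Phrase α} (h : ∀ w ∈ P, ∀ B ∈ w, B = A) :
    P.flatten = List.replicate (occ A (flat P) 0).length A := by
  rw [length_occ, ← count_reduceOption, reduceOption_flat]
  refine List.eq_replicate_iff.2 ⟨?_, fun B hB => ?_⟩
  · refine (List.count_eq_length.2 fun B hB => ?_).symm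
    obtain ⟨w, hw, hB⟩ := List.mem_flatten.1 hB
    exact (h w hw B hB).symm
  · obtain ⟨w, hw, hB⟩ := List.mem_flatten.1 hB
    exact h w hw B hB

theorem flat_eq_twice_of_occ {A : Letter α} {P : Phrase α} {i j : ℕ}
    (h : ∀ w ∈ P, ∀ B ∈ w, B = A) (hocc : occ A (flat P) 0 = [i, j]) :
    ∃ n₁ n₂, j = i + n₁ ∧ P.length = i + n₁ + n₂ + 1 ∧ flat P = twice A i n₁ n₂ := by
  have hfl := flatten_eq_replicate h
  rw [hocc, ← reduceOption_flat] at hfl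
  obtain ⟨n₀, n₁, n₂, hP⟩ := exists_eq_twice hfl
  rw [hP, occ_twice, List.cons.injEq, List.cons.injEq] at hocc
  obtain ⟨rfl, rfl, -⟩ := hocc
  refine ⟨n₁, n₂, rfl, ?_, hP⟩
  rw [← count_none_flat, hP, count_none_twice]
  rintro rfl
  simp [flat_nil, twice] at hP

theorem flat_eq_thrice_of_occ {A : Letter α} {P : Phrase α} {i j m : ℕ}
    (h : ∀ w ∈ P, ∀ B ∈ w, B = A) (hocc : occ A (flat P) 0 = [i, j, m]) :
    ∃ n₁ n₂ n₃, j = i + n₁ ∧ m = i + n₁ + n₂ ∧ P.length = i + n₁ + n₂ + n₃ + 1 ∧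
      flat P = thrice A i n₁ n₂ n₃ := by
  have hfl := flatten_eq_replicate h
  rw [hocc, ← reduceOption_flat] at hfl
  obtain ⟨n₀, n₁, n₂, n₃, hP⟩ := exists_eq_thrice hfl
  rw [hP, occ_thrice, List.cons.injEq, List.cons.injEq, List.cons.injEq] at hocc
  obtain ⟨rfl, rfl, rfl, -⟩ := hocc
  refine ⟨n₁, n₂, n₃, rfl, rfl, ?_, hP⟩
  rw [← count_none_flat, hP, count_none_thrice]
  rintro rfl
  simp [flat_nil, thrice] at hP

/-- The components of the occurrences of the letter of a model phrase. -/
def Model.places : Model k α → List ℕ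
  | .m11 l1 l2 _ => [l1, l2]
  | .m3 l _ => [l, l, l]
  | .m21 l1 l2 _ => [l1, l1, l2]
  | .m12 l1 l2 _ => [l1, l2, l2]
  | .m111 l1 l2 l3 _ => [l1, l2, l3]

theorem Model.occ_toPhrase {τ : α → α} {M : Model k α} (hM : M.valid τ) :
    occ (ofα M.letter) (flat M.toPhrase) 0 = M.places := by
  refine occ_flat_eq ?_ fun i => ?_
  · cases M <;> simp [valid, places] at hM ⊢ <;> omega
  · cases M <;> simp only [valid, places, Fin.lt_def, toPhrase, letter, P11, P3, P21, P12, P111,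
      getD_ofFn, List.count_cons, List.count_nil, Fin.ext_iff, beq_iff_eq] at hM ⊢ <;>
      split_ifs <;> first | omega | simp

theorem Model.shape {τ : α → α} {M : Model k α} (hM : M.valid τ) :
    (∃ n₀ n₁ n₂, 0 < n₁ ∧ flat M.toPhrase = twice (ofα M.letter) n₀ n₁ n₂) ∨
      ∃ n₀ n₁ n₂ n₃, (n₁ + n₂ = 0 → M.letter ≠ τ M.letter) ∧
        flat M.toPhrase = thrice (ofα M.letter) n₀ n₁ n₂ n₃ := by
  have hocc := M.occ_toPhrase hM
  cases M with
  | m11 l1 l2 a =>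
    obtain ⟨n₁, n₂, h1, -, h2⟩ := flat_eq_twice_of_occ (Model.eq_letter _) hocc
    have : l1.1 < l2.1 := hM
    exact .inl ⟨_, n₁, n₂, by omega, h2⟩
  | m3 l a =>
    obtain ⟨n₁, n₂, n₃, -, -, -, h⟩ := flat_eq_thrice_of_occ (Model.eq_letter _) hocc
    exact .inr ⟨_, n₁, n₂, n₃, fun _ => hM, h⟩
  | m21 l1 l2 a =>
    obtain ⟨n₁, n₂, n₃, h1, h2, -, h⟩ := flat_eq_thrice_of_occ (Model.eq_letter _) hocc
    have : l1.1 < l2.1 := hM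
    exact .inr ⟨_, n₁, n₂, n₃, fun _ => by omega, h⟩
  | m12 l1 l2 a =>
    obtain ⟨n₁, n₂, n₃, h1, h2, -, h⟩ := flat_eq_thrice_of_occ (Model.eq_letter _) hocc
    have : l1.1 < l2.1 := hM
    exact .inr ⟨_, n₁, n₂, n₃, fun _ => by omega, h⟩
  | m111 l1 l2 l3 a =>
    obtain ⟨n₁, n₂, n₃, h1, h2, -, h⟩ := flat_eq_thrice_of_occ (Model.eq_letter _) hocc
    have : l1.1 < l2.1 := hM.1
    exact .inr ⟨_, n₁, n₂, n₃, fun _ => by omega, h⟩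

theorem Homotopic.symm {τ : α → α} {P Q : Phrase α} (h : Homotopic τ P Q) :
    Homotopic τ Q P := by
  induction h with
  | refl => exact .refl
  | tail _ h ih => exact .head ⟨h.1.symm, h.2.2, h.2.1⟩ ih

theorem Model.toPhrase_eq_of_homotopic {τ : α → α} (hτ : Function.Involutive τ)
    {M N : Model k α} (hM : M.valid τ) (hN : N.valid τ)
    (h : EHomotopic τ M.toPhrase N.toPhrase) : M.toPhrase = N.toPhrase := by
  have h' : EHomotopic τ N.toPhrase M.toPhrase := Homotopic.symm h
  have hne : ∀ {K : Model k α}, K.valid τ → K.toPhrase ≠ [] := by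
    intro K hK
    refine ne_nil_of_occ (A := ofα K.letter) ?_
    rw [K.occ_toPhrase hK]
    cases K <;> simp [places]
  have hlen : (flat M.toPhrase).count none = (flat N.toPhrase).count none := by
    have h1 := count_none_flat (hne hM)
    have h2 := count_none_flat (hne hN)
    rw [Model.length_toPhrase] at h1 h2
    omega
  refine flat_injective (hne hM) (hne hN) ?_
  rcases M.shape hM with ⟨n₀, n₁, n₂, hn, hP⟩ | ⟨n₀, n₁, n₂, n₃, hn, hP⟩ <;>
    rcases N.shape hN with ⟨m₀, m₁, m₂, hm, hQ⟩ | ⟨m₀, m₁, m₂, m₃, hm, hQ⟩ <;>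
    rw [hP, hQ] at hlen ⊢
  · obtain ⟨hl : M.letter = N.letter, rfl, rfl⟩ := h.eq_of_twice hτ hP hQ hn
    rw [count_none_twice, count_none_twice] at hlen
    obtain rfl : n₂ = m₂ := by omega
    rw [hl]
  · exact (h.not_twice_thrice hτ hP hQ hn).elim
  · exact (h'.not_twice_thrice hτ hQ hP hm).elim
  · obtain ⟨hl : M.letter = N.letter, rfl, rfl, rfl⟩ := h.eq_of_thrice hτ hP hQ hn h'
    rw [count_none_thrice, count_none_thrice] at hlen
    obtain rfl : n₃ = m₃ := by omega
    rw [hl]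

end

/-! ### Homotopies between phrases with one letter -/

theorem flat_emptyP (n : ℕ) : flat (emptyP (n + 1) : Phrase α) = List.replicate n none := by
  induction n with
  | zero => simp [emptyP, flat_singleton]
  | succ n ih =>
    have h : (emptyP (n + 1 + 1) : Phrase α) = [] :: emptyP (n + 1) := by
      simp [emptyP, List.replicate_succ]
    rw [h, flat_cons _ (by simp [emptyP]), ih, List.map_nil, List.nil_append,
      List.replicate_succ]

section

variable [DecidableEq α]

theorem gaussList_twice (A : Letter α) (n₀ n₁ n₂ : ℕ) : GaussList (twice A n₀ n₁ n₂) := by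
  intro B hB
  obtain rfl : B = A := by
    simpa [twice, List.mem_replicate] using hB
  simp [twice, List.count_replicate]

theorem gaussList_tripod {X Y Z : Letter α} (hXY : X ≠ Y) (hXZ : X ≠ Z) (hYZ : Y ≠ Z)
    (n₀ n₁ n₂ n₃ : ℕ) : GaussList (tripod X Y Z n₀ n₁ n₂ n₃) := by
  intro B hB
  have : B = X ∨ B = Y ∨ B = Z := by
    simp [tripod, List.mem_replicate] at hB
    tauto
  rcases this with rfl | rfl | rfl <;>
    simp [tripod, List.count_replicate, hXY, hXZ, hYZ, hXY.symm, hXZ.symm, hYZ.symm]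

theorem gaussList_desing_twice {P : Phrase α} {A : Letter α} {n₀ n₁ n₂ : ℕ}
    (h : flat P = twice A n₀ n₁ n₂) : GaussList (flat (desing P)) := by
  rw [flat_desing_twice h]
  exact gaussList_twice _ _ _ _

theorem gaussList_desing_thrice {P : Phrase α} {A : Letter α} {n₀ n₁ n₂ n₃ : ℕ}
    (h : flat P = thrice A n₀ n₁ n₂ n₃) : GaussList (flat (desing P)) := by
  rw [flat_desing_thrice h]
  exact gaussList_tripod (dLetter_ne A (by simp)) (dLetter_ne A (by simp))
    (dLetter_ne A (by simp)) _ _ _ _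

theorem Homotopic.of_move {τ : α → α} {P Q : Phrase α} (h : Move τ P Q ∨ Move τ Q P)
    (hP : GaussList (flat P)) (hQ : GaussList (flat Q)) : Homotopic τ P Q :=
  .single ⟨h, (nanoIn_univ_iff P).2 hP, (nanoIn_univ_iff Q).2 hQ⟩

theorem desing_ne_nil {P : Phrase α} (h : P ≠ []) : desing P ≠ [] := by
  cases P with
  | nil => exact absurd rfl h
  | cons w P => simp [desing, desingAux]

theorem exists_rename (m n : ℕ) : ∃ f : ℕ → ℕ, Function.Injective f ∧
    ∀ i, f (Nat.pair m i) = Nat.pair n i := by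
  refine ⟨fun i => Nat.pair (Equiv.swap m n i.unpair.1) i.unpair.2, fun i j h => ?_, by simp⟩
  simp only [Nat.pair_eq_pair, (Equiv.swap m n).injective.eq_iff] at h
  rw [← Nat.pair_unpair i, ← Nat.pair_unpair j, h.1, h.2]

theorem Homotopic.of_rename {τ : α → α} {P Q : Phrase α} (hP : P ≠ []) (hQ : Q ≠ [])
    (hGP : GaussList (flat P)) (hGQ : GaussList (flat Q)) {f : ℕ → ℕ}
    (hf : Function.Injective f)
    (h : (flat P).map (Option.map fun A => (f A.1, A.2)) = flat Q) : Homotopic τ P Q := by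
  obtain rfl : rename f P = Q :=
    flat_injective (by simpa [rename] using hP) hQ ((flat_rename f P).trans h)
  exact .of_move (.inl (.iso f hf P)) hGP hGQ

theorem EHomotopic.of_twice {τ : α → α} {P Q : Phrase α} {A B : Letter α} {n₀ n₁ n₂ : ℕ}
    (hP : flat P = twice A n₀ n₁ n₂) (hQ : flat Q = twice B n₀ n₁ n₂) (hAB : A.2 = B.2) :
    EHomotopic τ P Q := by
  have hne : ∀ {R : Phrase α} {C : Letter α}, flat R = twice C n₀ n₁ n₂ → R ≠ [] := by
    rintro _ C hR rfl
    simp [flat_nil, twice] at hR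
  obtain ⟨f, hf, hfp⟩ := exists_rename A.1 B.1
  refine Homotopic.of_rename (desing_ne_nil (hne hP)) (desing_ne_nil (hne hQ))
    (gaussList_desing_twice hP) (gaussList_desing_twice hQ) hf ?_
  rw [flat_desing_twice hP, flat_desing_twice hQ]
  simp [twice, dLetter, hfp, hAB]

theorem EHomotopic.of_thrice {τ : α → α} {P Q : Phrase α} {A B : Letter α} {n₀ n₁ n₂ n₃ : ℕ}
    (hP : flat P = thrice A n₀ n₁ n₂ n₃) (hQ : flat Q = thrice B n₀ n₁ n₂ n₃)
    (hAB : A.2 = B.2) : EHomotopic τ P Q := by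
  have hne : ∀ {R : Phrase α} {C : Letter α}, flat R = thrice C n₀ n₁ n₂ n₃ → R ≠ [] := by
    rintro _ C hR rfl
    simp [flat_nil, thrice] at hR
  obtain ⟨f, hf, hfp⟩ := exists_rename A.1 B.1
  refine Homotopic.of_rename (desing_ne_nil (hne hP)) (desing_ne_nil (hne hQ))
    (gaussList_desing_thrice hP) (gaussList_desing_thrice hQ) hf ?_
  rw [flat_desing_thrice hP, flat_desing_thrice hQ]
  simp [tripod, dLetter, hfp, hAB]

theorem flat_desing_emptyP (n : ℕ) :
    flat (desing (emptyP (n + 1) : Phrase α)) = List.replicate n none := by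
  have := desingFlat_replicate_none_append
    (fun A => (emptyP (n + 1) : Phrase α).flatten.count A) n [] (fun _ => 0)
  rw [desing, flat_desingAux, flat_emptyP]
  simpa [desingFlat] using this

theorem gaussList_desing_emptyP (n : ℕ) :
    GaussList (flat (desing (emptyP (n + 1) : Phrase α))) := by
  intro A hA
  simp [flat_desing_emptyP, List.mem_replicate] at hA

theorem EHomotopic.emptyP_of_twice {τ : α → α} {P : Phrase α} {A : Letter α} {n₀ n₂ : ℕ}
    (hP : flat P = twice A n₀ 0 n₂) : EHomotopic τ P (emptyP (n₀ + n₂ + 1)) := by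
  refine Homotopic.of_move (.inl (.h1 _ _ (dLetter A 1 2) (List.replicate n₀ none)
    (List.replicate n₂ none) ?_ ?_)) (gaussList_desing_twice hP) (gaussList_desing_emptyP _)
  · simp [flat_desing_twice hP, twice]
  · simp [flat_desing_emptyP]

/-- The flattened phrase with a single nonempty component, spelled by letters projecting
to `a`. -/
def spell (a : α) (m n : ℕ) (w : List ℕ) : List (Option (Letter α)) :=
  List.replicate m none ++ w.map (fun i => some (i, a)) ++ List.replicate n none

theorem gaussList_spell (a : α) (m n : ℕ) {w : List ℕ} (hw : ∀ i ∈ w, w.count i = 2) :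
    GaussList (spell a m n w) := by
  rintro ⟨i, b⟩ hB
  have hi : i ∈ w ∧ a = b := by
    simpa [spell, List.mem_replicate] using hB
  obtain ⟨hi, rfl⟩ := hi
  have hinj : Function.Injective fun i : ℕ => some ((i, a) : Letter α) :=
    fun i j h => by simpa using h
  have := List.count_map_of_injective w _ hinj i
  simp [spell, List.count_replicate, this, hw i hi]

theorem Homotopic.of_spell_remove {τ : α → α} {a : α} {m n : ℕ} {P Q : Phrase α}
    (i : ℕ) (x y : List ℕ) (hP : flat P = spell a m n (x ++ [i, i] ++ y))
    (hQ : flat Q = spell a m n (x ++ y))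
    (hw : ∀ j ∈ x ++ [i, i] ++ y, (x ++ [i, i] ++ y).count j = 2)
    (hw' : ∀ j ∈ x ++ y, (x ++ y).count j = 2) : Homotopic τ P Q := by
  refine .of_move (.inl (.h1 P Q (i, a) (List.replicate m none ++ x.map fun i => some (i, a))
    ((y.map fun i => some (i, a)) ++ List.replicate n none) ?_ ?_))
    (hP ▸ gaussList_spell a m n hw) (hQ ▸ gaussList_spell a m n hw')
  · simp [hP, spell]
  · simp [hQ, spell]

theorem Homotopic.of_spell_cancel {τ : α → α} {a : α} (ha : a = τ a) {m n : ℕ}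
    {P Q : Phrase α} (i j : ℕ) (x y z : List ℕ)
    (hP : flat P = spell a m n (x ++ [i, j] ++ y ++ [j, i] ++ z))
    (hQ : flat Q = spell a m n (x ++ y ++ z))
    (hw : ∀ l ∈ x ++ [i, j] ++ y ++ [j, i] ++ z, (x ++ [i, j] ++ y ++ [j, i] ++ z).count l = 2)
    (hw' : ∀ l ∈ x ++ y ++ z, (x ++ y ++ z).count l = 2) : Homotopic τ P Q := by
  refine .of_move (.inl (.h2 P Q (i, a) (j, a)
    (List.replicate m none ++ x.map fun i => some (i, a)) (y.map fun i => some (i, a))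
    ((z.map fun i => some (i, a)) ++ List.replicate n none) ha ?_ ?_))
    (hP ▸ gaussList_spell a m n hw) (hQ ▸ gaussList_spell a m n hw')
  · simp [hP, spell]
  · simp [hQ, spell]

theorem Homotopic.of_spell_slide {τ : α → α} {a : α} {m n : ℕ}
    {P Q : Phrase α} (i j l : ℕ) (x y z t : List ℕ)
    (hP : flat P = spell a m n (x ++ [i, j] ++ y ++ [i, l] ++ z ++ [j, l] ++ t))
    (hQ : flat Q = spell a m n (x ++ [j, i] ++ y ++ [l, i] ++ z ++ [l, j] ++ t))
    (hw : ∀ r ∈ x ++ [i, j] ++ y ++ [i, l] ++ z ++ [j, l] ++ t,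
      (x ++ [i, j] ++ y ++ [i, l] ++ z ++ [j, l] ++ t).count r = 2)
    (hw' : ∀ r ∈ x ++ [j, i] ++ y ++ [l, i] ++ z ++ [l, j] ++ t,
      (x ++ [j, i] ++ y ++ [l, i] ++ z ++ [l, j] ++ t).count r = 2) : Homotopic τ P Q := by
  refine .of_move (.inl (.h3 P Q (i, a) (j, a) (l, a)
    (List.replicate m none ++ x.map fun i => some (i, a)) (y.map fun i => some (i, a))
    (z.map fun i => some (i, a)) ((t.map fun i => some (i, a)) ++ List.replicate n none)
    rfl rfl ?_ ?_))
    (hP ▸ gaussList_spell a m n hw) (hQ ▸ gaussList_spell a m n hw')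
  · simp [hP, spell]
  · simp [hQ, spell]

/-- A single letter of multiplicity three whose projection is fixed by `τ` can be removed. -/
theorem Homotopic.of_spell_tripod {τ : α → α} {a : α} (ha : a = τ a) {m n : ℕ}
    {P Q : Phrase α} (hP : flat P = spell a m n [25, 100, 25, 121, 100, 121])
    (hQ : flat Q = spell a m n []) : Homotopic τ P Q := by
  obtain ⟨P₁, h₁⟩ := exists_flat_eq (spell a m n [100, 25, 121, 25, 121, 100])
  obtain ⟨P₂, h₂⟩ := exists_flat_eq (spell a m n [100, 0, 1, 25, 121, 1, 0, 25, 121, 100])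
  obtain ⟨P₃, h₃⟩ := exists_flat_eq
    (spell a m n [100, 0, 2, 3, 1, 25, 121, 1, 0, 25, 121, 3, 2, 100])
  obtain ⟨P₄, h₄⟩ := exists_flat_eq
    (spell a m n [100, 0, 2, 1, 3, 25, 1, 121, 0, 25, 3, 121, 2, 100])
  obtain ⟨P₅, h₅⟩ := exists_flat_eq (spell a m n [100, 0, 2, 1, 1, 121, 0, 121, 2, 100])
  obtain ⟨P₆, h₆⟩ := exists_flat_eq (spell a m n [100, 0, 2, 121, 0, 121, 2, 100])
  obtain ⟨P₇, h₇⟩ := exists_flat_eq (spell a m n [100, 0, 0, 100])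
  have e₁ : Homotopic τ P P₁ :=
    .of_spell_slide 25 100 121 [] [] [] [] hP h₁ (by decide) (by decide)
  have e₂ : Homotopic τ P₂ P₁ :=
    .of_spell_cancel ha 0 1 [100] [25, 121] [25, 121, 100] h₂ h₁ (by decide) (by decide)
  have e₃ : Homotopic τ P₃ P₂ :=
    .of_spell_cancel ha 2 3 [100, 0] [1, 25, 121, 1, 0, 25, 121] [100] h₃ h₂ (by decide) (by decide)
  have e₄ : Homotopic τ P₄ P₃ :=
    .of_spell_slide 1 3 121 [100, 0, 2] [25] [0, 25] [2, 100] h₄ h₃ (by decide) (by decide)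
  have e₅ : Homotopic τ P₄ P₅ :=
    .of_spell_cancel ha 3 25 [100, 0, 2, 1] [1, 121, 0] [121, 2, 100] h₄ h₅ (by decide) (by decide)
  have e₆ : Homotopic τ P₅ P₆ :=
    .of_spell_remove 1 [100, 0, 2] [121, 0, 121, 2, 100] h₅ h₆ (by decide) (by decide)
  have e₇ : Homotopic τ P₆ P₇ :=
    .of_spell_cancel ha 2 121 [100, 0] [0] [100] h₆ h₇ (by decide) (by decide)
  have e₈ : Homotopic τ P₇ Q :=
    .of_spell_cancel ha 100 0 [] [] [] h₇ hQ (by decide) (by decide)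
  exact e₁.trans <| e₂.symm.trans <| e₃.symm.trans <| e₄.symm.trans <|
    e₅.trans <| e₆.trans <| e₇.trans e₈

theorem EHomotopic.emptyP_of_thrice {τ : α → α} {P : Phrase α} {A : Letter α} {n₀ n₃ : ℕ}
    (hA : A.2 = τ A.2) (hP : flat P = thrice A n₀ 0 0 n₃) :
    EHomotopic τ P (emptyP (n₀ + n₃ + 1)) := by
  obtain ⟨Q, hQ⟩ := exists_flat_eq (thrice ((0, A.2) : Letter α) n₀ 0 0 n₃)
  refine (EHomotopic.of_thrice hP hQ rfl).trans (Homotopic.of_spell_tripod hA (m := n₀) (n := n₃)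
    ?_ ?_)
  · rw [flat_desing_thrice hQ]
    simp [tripod, spell, dLetter, Nat.pair]
  · simp [flat_desing_emptyP, spell]

theorem classification_exists {τ : α → α} {P : Phrase α}
    (hmof : ∀ A ∈ P.flatten, 2 ≤ P.flatten.count A) (hle3 : P.flatten.length ≤ 3) :
    EHomotopic τ P (emptyP P.length) ∨
      ∃ M : Model P.length α, M.valid τ ∧ EHomotopic τ P M.toPhrase := by
  have hnone : ∀ {l : List (Option (Letter α))} {A : Letter α}, flat P = l → some A ∈ l →
      P.length = l.count none + 1 := by
    rintro l A rfl hA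
    rw [count_none_flat]
    rintro rfl
    simp [flat_nil] at hA
  rcases hfl : P.flatten with _ | ⟨A, _ | ⟨B, _ | ⟨C, _ | ⟨D, w⟩⟩⟩⟩
  · left
    have : P = emptyP P.length :=
      List.eq_replicate_of_mem fun w hw => by
        simpa using List.flatten_eq_nil_iff.1 hfl w hw
    rw [← this]
    exact Relation.ReflTransGen.refl
  · simp [hfl] at hmof
  · obtain rfl : A = B := by
      have := hmof A (by simp [hfl])
      by_contra h
      simp [hfl, Ne.symm h] at this
    obtain ⟨n₀, n₁, n₂, hP⟩ := exists_eq_twice ((reduceOption_flat P).trans hfl)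
    have hk := hnone (A := A) hP (by simp [twice])
    rw [count_none_twice] at hk
    rcases Nat.eq_zero_or_pos n₁ with rfl | h₁
    · left
      rw [hk]
      exact EHomotopic.emptyP_of_twice hP
    · right
      let M : Model P.length α := .m11 ⟨n₀, by omega⟩ ⟨n₀ + n₁, by omega⟩ A.2
      have hM : M.valid τ := by simp [M, Model.valid, h₁]
      refine ⟨M, hM, ?_⟩
      obtain ⟨m₁, m₂, e₁, e₂, hQ⟩ := flat_eq_twice_of_occ M.eq_letter (M.occ_toPhrase hM)
      simp only [Model.length_toPhrase] at e₁ e₂ hQ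
      obtain ⟨rfl, rfl⟩ : n₁ = m₁ ∧ n₂ = m₂ := by omega
      exact EHomotopic.of_twice hP hQ rfl
  · have hBC : A = B ∧ A = C := by
      have hA := hmof A (by simp [hfl])
      have hB := hmof B (by simp [hfl])
      have hC := hmof C (by simp [hfl])
      simp only [hfl, List.count_cons, List.count_nil, beq_iff_eq] at hA hB hC
      by_cases h1 : A = B
      · subst h1
        refine ⟨rfl, ?_⟩
        by_contra h2
        simp [h2] at hC
      · exfalso
        by_cases h2 : A = C
        · subst h2
          simp [h1] at hB
        · simp [Ne.symm h1, Ne.symm h2] at hA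
    obtain ⟨rfl, rfl⟩ := hBC
    obtain ⟨n₀, n₁, n₂, n₃, hP⟩ := exists_eq_thrice ((reduceOption_flat P).trans hfl)
    have hk := hnone (A := A) hP (by simp [thrice])
    rw [count_none_thrice] at hk
    have of_model : ∀ M : Model P.length α, M.letter = A.2 →
        M.places = [n₀, n₀ + n₁, n₀ + n₁ + n₂] → M.valid τ →
        ∃ M : Model P.length α, M.valid τ ∧ EHomotopic τ P M.toPhrase := by
      intro M hMA hMp hM
      refine ⟨M, hM, ?_⟩
      obtain ⟨m₁, m₂, m₃, e₁, e₂, e₃, hQ⟩ :=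
        flat_eq_thrice_of_occ M.eq_letter ((M.occ_toPhrase hM).trans hMp)
      rw [Model.length_toPhrase] at e₃
      obtain ⟨rfl, rfl, rfl⟩ : n₁ = m₁ ∧ n₂ = m₂ ∧ n₃ = m₃ := by omega
      exact EHomotopic.of_thrice hP hQ hMA.symm
    rcases Nat.eq_zero_or_pos n₁ with rfl | h₁ <;> rcases Nat.eq_zero_or_pos n₂ with rfl | h₂
    · by_cases hA : A.2 = τ A.2
      · left
        rw [hk]
        exact EHomotopic.emptyP_of_thrice hA hP
      · exact .inr (of_model (.m3 ⟨n₀, by omega⟩ A.2) rfl rfl hA)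
    · exact .inr (of_model (.m21 ⟨n₀, by omega⟩ ⟨n₀ + n₂, by omega⟩ A.2) rfl rfl
        (by simp [Model.valid, h₂]))
    · exact .inr (of_model (.m12 ⟨n₀, by omega⟩ ⟨n₀ + n₁, by omega⟩ A.2) rfl rfl
        (by simp [Model.valid, h₁]))
    · exact .inr (of_model (.m111 ⟨n₀, by omega⟩ ⟨n₀ + n₁, by omega⟩ ⟨n₀ + n₁ + n₂, by omega⟩ A.2)
        rfl rfl (by simp [Model.valid, h₁, h₂]))
  · simp [hfl] at hle3
    omega

end

/-- **Homotopy classification of étale phrases with at most three letters**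
(Theorem 4.1 of the paper).  Let `P` be a multiplicity-one-free étale phrase of
length `k` over `α` whose total length is at most three.  Then `P` is homotopic
to the empty phrase `(∅)_k` or to one of the model phrases `P^{1,1;l₁,l₂}_a`,
`P^{3;l}_a` (with `a ≠ τ(a)`), `P^{2,1;l₁,l₂}_a`, `P^{1,2;l₁,l₂}_a`,
`P^{1,1,1;l₁,l₂,l₃}_a`.  Moreover two model phrases are homotopic if and only
if they are equal. -/
theorem classification_of_etale_phrases_with_at_most_three_letters
    {α : Type*} [Fintype α] [DecidableEq α] (τ : α → α) (hτ : Function.Involutive τ)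
    (k : ℕ) (P : Phrase α) (hlen : P.length = k)
    (hmof : ∀ A ∈ P.flatten, 2 ≤ P.flatten.count A)
    (hle3 : P.flatten.length ≤ 3) :
    (EHomotopic τ P (emptyP k) ∨
      ∃ M : Model k α, M.valid τ ∧ EHomotopic τ P M.toPhrase) ∧
    (∀ M N : Model k α, M.valid τ → N.valid τ →
      (EHomotopic τ M.toPhrase N.toPhrase ↔ M.toPhrase = N.toPhrase)) := by
  subst hlen
  refine ⟨classification_exists hmof hle3, fun M N hM hN =>
    ⟨fun h => Model.toPhrase_eq_of_homotopic hτ hM hN h, fun h => ?_⟩⟩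
  rw [h]
  exact Relation.ReflTransGen.refl

end Nano
end

section
/- If two nanophrases P and Q of length k over α are homotopic, then their linking vectors coincide: lk(P) = lk(Q) in π^{k(k-1)/2}. -/
namespace Nano

variable {α : Type*}

/-- The abelian group `π` generated by the elements of `α` with relations
`a·τ(a) = 1` for all `a ∈ α` (written additively). -/
abbrev PiGroup (τ : α → α) :=
  FreeAbelianGroup α ⧸ AddSubgroup.closure
    {x : FreeAbelianGroup α | ∃ a : α, x = FreeAbelianGroup.of a + FreeAbelianGroup.of (τ a)}

/-- The linking number `l_P(i,j) = ∏_{A ∈ Im(w_i) ∩ Im(w_j)} |A| ∈ π`. -/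
def lk [DecidableEq α] (τ : α → α) (P : Phrase α) (i j : ℕ) : PiGroup τ :=
  ∑ A ∈ (comp P i).toFinset ∩ (comp P j).toFinset,
    (QuotientAddGroup.mk (FreeAbelianGroup.of A.2) : PiGroup τ)

theorem flat_cons_cons (w v : List (Letter α)) (P : Phrase α) :
    flat (w :: v :: P) = w.map some ++ none :: flat (v :: P) := by
  simp [flat, List.intercalate]

/-- The letters of component `i` in a flattened phrase whose first component has index `n`. -/
def segment : ℕ → List (Option (Letter α)) → ℕ → List (Letter α)
  | _, [], _ => []
  | n, none :: l, i => segment (n + 1) l i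
  | n, some a :: l, i => (if i = n then [a] else []) ++ segment n l i

/-- The number of separators in a flattened phrase. -/
def separators : List (Option (Letter α)) → ℕ
  | [] => 0
  | none :: l => separators l + 1
  | some _ :: l => separators l

theorem segment_append (x y : List (Option (Letter α))) (n i : ℕ) :
    segment n (x ++ y) i = segment n x i ++ segment (n + separators x) y i := by
  induction x generalizing n with
  | nil => simp [segment, separators]
  | cons a x ih =>
    cases a with
    | none => simp [segment, separators, ih, Nat.add_assoc, Nat.add_comm 1]
    | some a => simp [segment, separators, ih]

theorem separators_append (x y : List (Option (Letter α))) :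
    separators (x ++ y) = separators x + separators y := by
  induction x with
  | nil => simp [separators]
  | cons a x ih => cases a <;> simp [separators, ih, Nat.add_right_comm]

theorem mem_of_mem_segment {A : Letter α} {l : List (Option (Letter α))} {n i : ℕ}
    (h : A ∈ segment n l i) : some A ∈ l := by
  induction l generalizing n with
  | nil => simp [segment] at h
  | cons a l ih =>
    cases a with
    | none => exact List.mem_cons_of_mem _ (ih h)
    | some a =>
      rcases List.mem_append.1 h with h | h
      · split_ifs at h <;> simp_all
      · exact List.mem_cons_of_mem _ (ih h)

theorem segment_map_some (w : List (Letter α)) (n i : ℕ) :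
    segment n (w.map some) i = if i = n then w else [] := by
  induction w with
  | nil => simp [segment]
  | cons a w ih => by_cases h : i = n <;> simp_all [segment]

theorem separators_map_some (w : List (Letter α)) : separators (w.map some) = 0 := by
  induction w with
  | nil => rfl
  | cons a w ih => simpa [separators] using ih

theorem segment_flat (P : Phrase α) (n i : ℕ) :
    segment n (flat P) i = if i < n then [] else comp P (i - n) := by
  induction P generalizing n with
  | nil => simp [flat, List.intercalate, segment, comp]
  | cons w P ih =>
    cases P with
    | nil =>
      have : flat [w] = w.map some := by simp [flat, List.intercalate]
      rw [this, segment_map_some]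
      rcases lt_trichotomy i n with h | rfl | h
      · simp [h, h.ne]
      · simp [comp]
      · obtain ⟨m, rfl⟩ := Nat.exists_eq_add_of_lt h
        have : n + m + 1 - n = m + 1 := by omega
        simp [comp, this]
        omega
    | cons v P =>
      rw [flat_cons_cons, segment_append, segment_map_some, separators_map_some]
      simp only [segment, ih]
      rcases lt_trichotomy i n with h | rfl | h
      · simp [h, h.ne, Nat.lt_succ_of_lt h]
      · simp [comp]
      · obtain ⟨m, rfl⟩ := Nat.exists_eq_add_of_lt h
        have h₁ : n + m + 1 - n = m + 1 := by omega
        have h₂ : n + m + 1 - (n + 1) = m := by omega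
        have h₃ : ¬ n + m + 1 = n := by omega
        have h₄ : ¬ n + m + 1 < n := by omega
        simp [comp, h₁, h₂, h₃, h₄]

theorem comp_eq_segment (P : Phrase α) (i : ℕ) : comp P i = segment 0 (flat P) i := by
  simp [segment_flat]

theorem count_flat [DecidableEq α] (P : Phrase α) (A : Letter α) :
    (flat P).count (some A) = P.flatten.count A := by
  induction P with
  | nil => simp [flat, List.intercalate]
  | cons w P ih =>
    have hw : (w.map some).count (some A) = w.count A :=
      List.count_map_of_injective _ _ (Option.some_injective _) _
    cases P with
    | nil => simpa [flat, List.intercalate] using hw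
    | cons v P => simp [flat_cons_cons, ih, hw]

theorem IsGauss.count_flat_le [DecidableEq α] {P : Phrase α} (hP : IsGauss P) (A : Letter α) :
    (flat P).count (some A) ≤ 2 := by
  rw [count_flat]
  by_cases h : A ∈ P.flatten
  · exact (hP A h).le
  · simp [List.count_eq_zero_of_not_mem h]

theorem lk_rename [DecidableEq α] (τ : α → α) {f : ℕ → ℕ} (hf : Function.Injective f)
    (P : Phrase α) (i j : ℕ) : lk τ (rename f P) i j = lk τ P i j := by
  have hg : Function.Injective fun A : Letter α => (f A.1, A.2) := by
    rintro ⟨a, b⟩ ⟨c, d⟩ h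
    simp only [Prod.mk.injEq] at h
    rw [hf h.1, h.2]
  have hc (i : ℕ) : (comp (rename f P) i).toFinset =
      (comp P i).toFinset.image fun A => (f A.1, A.2) := by
    have : comp (rename f P) i = (comp P i).map fun A => (f A.1, A.2) := by
      simp only [comp, rename, List.getD_eq_getElem?_getD, List.getElem?_map]
      cases P[i]? <;> simp
    ext A
    simp [this]
  unfold lk
  rw [hc, hc, ← Finset.image_inter _ _ hg, Finset.sum_image hg.injOn]

theorem mk_of_add_mk_of (τ : α → α) (a : α) :
    (QuotientAddGroup.mk (FreeAbelianGroup.of a) : PiGroup τ) +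
      QuotientAddGroup.mk (FreeAbelianGroup.of (τ a)) = 0 := by
  rw [← QuotientAddGroup.mk_add, QuotientAddGroup.eq_zero_iff]
  exact AddSubgroup.subset_closure ⟨a, rfl⟩

theorem Move.lk_eq [DecidableEq α] {τ : α → α} {P Q : Phrase α} (h : Move τ P Q)
    (hP : IsGauss P) {i j : ℕ} (hij : i ≠ j) : lk τ P i j = lk τ Q i j := by
  cases h with
  | iso f hf => exact (lk_rename τ hf P i j).symm
  | h1 _ _ A x y hPx hQx =>
    have hA := hP.count_flat_le A
    simp only [hPx, List.count_append, List.count_cons_self, List.count_nil] at hA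
    have hx : some A ∉ x := List.count_eq_zero.1 (by omega)
    have hy : some A ∉ y := List.count_eq_zero.1 (by omega)
    unfold lk
    congr 1
    ext D
    simp only [comp_eq_segment, hPx, hQx, segment_append, separators_append, segment, separators,
      Finset.mem_inter, List.mem_toFinset, List.mem_append, Nat.add_zero, Nat.zero_add]
    by_cases hD : D = A
    · subst hD
      have hx' (n i : ℕ) : D ∉ segment n x i := fun h => hx (mem_of_mem_segment h)
      have hy' (n i : ℕ) : D ∉ segment n y i := fun h => hy (mem_of_mem_segment h)
      simp only [hx', hy']
      split_ifs <;> simp_all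
    · split_ifs <;> simp [hD]
  | h2 _ _ A B x y z hAB hPx hQx =>
    have hA := hP.count_flat_le A
    have hB := hP.count_flat_le B
    have hne : A ≠ B := by
      rintro rfl
      simp only [hPx, List.count_append, List.count_cons_self, List.count_nil] at hA
      omega
    simp only [hPx, List.count_append, List.count_cons, List.count_nil, beq_self_eq_true,
      if_true] at hA hB
    have hAx : some A ∉ x := List.count_eq_zero.1 (by omega)
    have hAy : some A ∉ y := List.count_eq_zero.1 (by omega)
    have hAz : some A ∉ z := List.count_eq_zero.1 (by omega)
    have hBx : some B ∉ x := List.count_eq_zero.1 (by omega)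
    have hBy : some B ∉ y := List.count_eq_zero.1 (by omega)
    have hBz : some B ∉ z := List.count_eq_zero.1 (by omega)
    set p := separators x with hp
    set q := separators x + separators y
    have hnQ (i : ℕ) : A ∉ comp Q i ∧ B ∉ comp Q i := by
      simp only [comp_eq_segment, hQx]
      constructor <;> intro h <;> have := mem_of_mem_segment h <;> simp_all
    have hmem (i : ℕ) (D : Letter α) :
        D ∈ comp P i ↔ D ∈ comp Q i ∨ ((i = p ∨ i = q) ∧ (D = A ∨ D = B)) := by
      simp only [comp_eq_segment, hPx, hQx, segment_append, separators_append, segment,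
        separators, List.mem_append, Nat.add_zero, Nat.zero_add, ← hp]
      split_ifs <;> simp_all <;> tauto
    by_cases hpq : (i = p ∨ i = q) ∧ (j = p ∨ j = q)
    · have hset : (comp P i).toFinset ∩ (comp P j).toFinset =
          ((comp Q i).toFinset ∩ (comp Q j).toFinset) ∪ {A, B} := by
        ext D
        simp only [Finset.mem_inter, List.mem_toFinset, hmem, hpq.1, hpq.2, true_and,
          Finset.mem_union, Finset.mem_insert, Finset.mem_singleton, and_or_right]
      have hdisj : Disjoint ((comp Q i).toFinset ∩ (comp Q j).toFinset) {A, B} := by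
        simp [Finset.disjoint_right, hnQ]
      unfold lk
      rw [hset, Finset.sum_union hdisj, Finset.sum_pair hne, hAB, mk_of_add_mk_of, add_zero]
    · unfold lk
      congr 1
      ext D
      simp only [Finset.mem_inter, List.mem_toFinset, hmem]
      by_cases hD : D = A ∨ D = B
      · have hDn (i : ℕ) : D ∉ comp Q i := by
          rcases hD with rfl | rfl
          exacts [(hnQ i).1, (hnQ i).2]
        simpa only [hDn, hD, false_or, and_true, false_and, iff_false] using hpq
      · simp only [hD, and_false, or_false]
  | h3 _ _ A B C x y z t hAB hBC hPx hQx =>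
    have hset (i : ℕ) : (comp P i).toFinset = (comp Q i).toFinset := by
      ext D
      simp only [comp_eq_segment, hPx, hQx, segment_append, separators_append, segment,
        separators, List.mem_toFinset, List.mem_append]
      tauto
    simp only [lk, hset]

/-- **The linking vector is a homotopy invariant** (Proposition 3.2): if two
nanophrases `P` and `Q` of length `k` over `α` are homotopic, then
`lk(P) = lk(Q)` in `π^{k(k-1)/2}`. -/
theorem linking_vector_invariant
    {α : Type*} [Fintype α] [DecidableEq α] (τ : α → α) (hτ : Function.Involutive τ)
    (k : ℕ) (P Q : Phrase α) (hPk : P.length = k) (hQk : Q.length = k)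
    (hP : IsGauss P) (hQ : IsGauss Q) (h : Homotopic τ P Q) :
    ∀ i j : Fin k, i < j → lk τ P i j = lk τ Q i j := by
  intro i j hij
  have hne : (i : ℕ) ≠ j := Fin.val_ne_of_ne hij.ne
  clear hPk hQk hP hQ
  induction h with
  | refl => rfl
  | tail _ hstep ih =>
    obtain ⟨hmove | hmove, hX, hY⟩ := hstep
    · exact ih.trans (hmove.lk_eq hX.1 hne)
    · exact ih.trans (hmove.lk_eq hY.1 hne).symm

end Nano
end
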